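/- arXiv:2402.17755 — 6 statements merged into one kernel-verified Lean document; each statement's English description precedes it below -/
import Mathlib

section
/- For every integer i ≥ 0, the set {c ∈ K : c·T^i ∈ B} equals p^{[i]−i}·W(k) ⊆ K (with the convention [0] := 0). Equivalently, the degree-i homogeneous component B^i of B is the free W(k)-module generated by (p^{[i]}/p^i)·v_+^i. -/
noncomputable section

open LaurentPolynomial

/-- The fraction field `K = Frac(W(k))` of the ring of `p`-typical Witt vectors. -/
abbrev FracW (p : ℕ) [Fact p.Prime] (k : Type*) [CommRing k] :=
  FractionRing (WittVector p k)

/-- The `W(k)`-subalgebra `B` of the Laurent polynomial ring `K[T,T⁻¹]` generated by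
`p·T⁻¹` together with the divided powers `T^n/n!` for all `n ≥ 1`. -/
def Bsub (p : ℕ) [Fact p.Prime] (k : Type*) [Field k] [CharP k p] :
    Subalgebra (WittVector p k) (LaurentPolynomial (FracW p k)) :=
  Algebra.adjoin (WittVector p k)
    ({LaurentPolynomial.C ((p : FracW p k)) * T (-1)} ∪
      {f | ∃ n : ℕ, 1 ≤ n ∧
        f = LaurentPolynomial.C ((Nat.factorial n : FracW p k)⁻¹) * T (n : ℤ)})

theorem isUnit_natCast_witt (p : ℕ) [Fact p.Prime] (k : Type*) [Field k] [CharP k p]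
    [PerfectRing k p] (u : ℕ) (hu : ¬ p ∣ u) : IsUnit (u : WittVector p k) := by
  apply WittVector.isUnit_of_coeff_zero_ne_zero
  have h : (u : WittVector p k).coeff 0 = (u : k) :=
    map_natCast (WittVector.constantCoeff (p := p) (R := k)) u
  rw [h]
  exact fun h0 => hu ((CharP.cast_eq_zero_iff k p u).1 h0)

theorem p_ne_zero_fracW (p : ℕ) [Fact p.Prime] (k : Type*) [Field k] [CharP k p]
    [PerfectRing k p] : (p : FracW p k) ≠ 0 := by
  have h := WittVector.p_nonzero p k
  intro h0
  apply h
  apply IsFractionRing.injective (WittVector p k) (FracW p k)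
  simpa using h0

theorem unit_ne_zero_fracW (p : ℕ) [Fact p.Prime] (k : Type*) [Field k] [CharP k p]
    [PerfectRing k p] (u : ℕ) (hu : ¬ p ∣ u) : (u : FracW p k) ≠ 0 := by
  have h := ((isUnit_natCast_witt p k u hu).map (algebraMap _ (FracW p k))).ne_zero
  simpa using h

theorem factorial_split (p : ℕ) [hp : Fact p.Prime] (m : ℕ) :
    ∃ u : ℕ, ¬ p ∣ u ∧ m.factorial = p ^ (padicValNat p m.factorial) * u := by
  refine ⟨m.factorial / p ^ (padicValNat p m.factorial), ?_, ?_⟩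
  · have := Nat.not_dvd_ordCompl hp.out (Nat.factorial_ne_zero m)
    rwa [Nat.factorization_def _ hp.out] at this
  · exact (Nat.mul_div_cancel' pow_padicValNat_dvd).symm

theorem padicVal_factorial_le (p : ℕ) [hp : Fact p.Prime] (m : ℕ) :
    padicValNat p m.factorial ≤ m := by
  have h := sub_one_mul_padicValNat_factorial (p := p) m
  have h2 := hp.out.two_le
  have h3 : 1 * padicValNat p m.factorial ≤ (p - 1) * padicValNat p m.factorial :=
    Nat.mul_le_mul_right _ (by omega)
  omega

theorem factorial_ne_zero_fracW (p : ℕ) [Fact p.Prime] (k : Type*) [Field k] [CharP k p]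
    [PerfectRing k p] (m : ℕ) : (m.factorial : FracW p k) ≠ 0 := by
  obtain ⟨u, hu, h⟩ := factorial_split p m
  rw [h]
  push_cast
  exact mul_ne_zero (pow_ne_zero _ (p_ne_zero_fracW p k)) (unit_ne_zero_fracW p k u hu)

theorem coeff_C_mul_T {R : Type*} [CommRing R] (a : R) (n i : ℤ) :
    (LaurentPolynomial.C a * T n).coeff i = if n = i then a else 0 := by
  rw [← single_eq_C_mul_T, AddMonoidAlgebra.coeff_single]
  exact Finsupp.single_apply

theorem closure_form (p : ℕ) [Fact p.Prime] (k : Type*) [Field k] [CharP k p]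
    [PerfectRing k p] (f : LaurentPolynomial (FracW p k))
    (hf : f ∈ Submonoid.closure
      (({LaurentPolynomial.C ((p : FracW p k)) * T (-1)} ∪
      {f | ∃ n : ℕ, 1 ≤ n ∧
        f = LaurentPolynomial.C ((Nat.factorial n : FracW p k)⁻¹) * T (n : ℤ)}) :
        Set (LaurentPolynomial (FracW p k)))) :
    ∃ n j m : ℕ, f = LaurentPolynomial.C
      ((n : FracW p k) * (p : FracW p k) ^ j * (m.factorial : FracW p k)⁻¹) *
        T ((m : ℤ) - j) := by
  induction hf using Submonoid.closure_induction with
  | mem x hx =>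
    rcases hx with hx | ⟨n, -, hx⟩
    · refine ⟨1, 1, 0, ?_⟩
      rw [Set.mem_singleton_iff.1 hx]
      simp
    · refine ⟨1, 0, n, ?_⟩
      rw [hx]
      simp
  | one => exact ⟨1, 0, 0, by simp⟩
  | mul x y _ _ hx hy =>
    obtain ⟨n, j, m, rfl⟩ := hx
    obtain ⟨n', j', m', rfl⟩ := hy
    refine ⟨n * n' * (m + m').choose m, j + j', m + m', ?_⟩
    have h1 := factorial_ne_zero_fracW p k m
    have h2 := factorial_ne_zero_fracW p k m'
    have h3 := factorial_ne_zero_fracW p k (m + m')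
    have h4 : ((m + m').choose m : FracW p k) * m.factorial * m'.factorial
        = (m + m').factorial := by
      have := Nat.add_choose_mul_factorial_mul_factorial m m'
      rw [← Nat.choose_symm_add] at this
      rw [← this]
      push_cast
      ring
    have h5 : (n : FracW p k) * (p : FracW p k) ^ j * (m.factorial : FracW p k)⁻¹ *
        ((n' : FracW p k) * (p : FracW p k) ^ j' * (m'.factorial : FracW p k)⁻¹) =
        ((n * n' * (m + m').choose m : ℕ) : FracW p k) * (p : FracW p k) ^ (j + j') *
          ((m + m').factorial : FracW p k)⁻¹ := by
      push_cast
      field_simp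
      rw [← h4]
      ring
    rw [← h5, map_mul LaurentPolynomial.C (_ * _ * _) (_ * _ * _), show (((m + m' : ℕ) : ℤ) - ((j + j' : ℕ) : ℤ)) =
      ((m : ℤ) - j) + ((m' : ℤ) - j') by push_cast; ring, T_add]
    exact mul_mul_mul_comm _ _ _ _

theorem coeff_form (p : ℕ) [Fact p.Prime] (k : Type*) [Field k] [CharP k p]
    [PerfectRing k p] (i : ℕ) (L : ℤ)
    (hmin : ∀ m : ℕ, i ≤ m → L ≤ (m : ℤ) - padicValNat p (Nat.factorial m))
    (f : LaurentPolynomial (FracW p k)) (hf : f ∈ Bsub p k) :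
    ∃ w : WittVector p k, f.coeff (i : ℤ) =
      (p : FracW p k) ^ (L - (i : ℤ)) * algebraMap (WittVector p k) (FracW p k) w := by
  have hp0 := p_ne_zero_fracW p k
  have hf' : f ∈ Subalgebra.toSubmodule (Bsub p k) := hf
  rw [Bsub, Algebra.adjoin_eq_span] at hf'
  induction hf' using Submodule.span_induction with
  | mem x hx =>
    obtain ⟨n, j, m, rfl⟩ := closure_form p k x hx
    rw [coeff_C_mul_T]
    by_cases hij : (m : ℤ) - j = i
    · obtain ⟨u, hu, h⟩ := factorial_split p m
      obtain ⟨v, hv⟩ := isUnit_natCast_witt p k u hu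
      have hm := hmin m (by omega)
      obtain ⟨t, ht⟩ := Int.eq_ofNat_of_zero_le (sub_nonneg.2 hm)
      have hu0 := unit_ne_zero_fracW p k u hu
      refine ⟨n * p ^ t * (↑v⁻¹ : WittVector p k), ?_⟩
      have hvi : algebraMap (WittVector p k) (FracW p k) (↑v⁻¹ : WittVector p k) =
          (u : FracW p k)⁻¹ := by
        apply eq_inv_of_mul_eq_one_left
        rw [← map_natCast (algebraMap (WittVector p k) (FracW p k)) u, ← hv, ← map_mul]
        simp
      rw [if_pos hij]
      simp only [map_mul, map_pow, map_natCast, hvi]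
      have hj : (p : FracW p k) ^ j = p ^ (L - (i : ℤ)) * p ^ t * p ^ (padicValNat p m.factorial) := by
        simp only [← zpow_natCast]
        rw [← zpow_add₀ hp0, ← zpow_add₀ hp0]
        congr 1
        omega
      rw [h, hj]
      push_cast
      field_simp
    · refine ⟨0, ?_⟩
      rw [if_neg hij]
      simp
  | zero => exact ⟨0, by simp⟩
  | add x y _ _ hx hy =>
    obtain ⟨w, hw⟩ := hx (by rw [Bsub, ← Subalgebra.mem_toSubmodule, Algebra.adjoin_eq_span]; assumption)
    obtain ⟨w', hw'⟩ := hy (by rw [Bsub, ← Subalgebra.mem_toSubmodule, Algebra.adjoin_eq_span]; assumption)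
    refine ⟨w + w', ?_⟩
    simp [hw, hw', mul_add]
  | smul a x _ hx =>
    obtain ⟨w, hw⟩ := hx (by rw [Bsub, ← Subalgebra.mem_toSubmodule, Algebra.adjoin_eq_span]; assumption)
    refine ⟨a * w, ?_⟩
    have h : (a • x).coeff (i : ℤ) = a • x.coeff (i : ℤ) := rfl
    rw [h, hw, Algebra.smul_def, map_mul]
    ring

/-- For every integer `i ≥ 0`, the set `{c ∈ K : c·T^i ∈ B}` equals
`p^{[i]−i}·W(k) ⊆ K` (with the convention `[0] := 0`), where `[i]` is the Mazur number
of `i`, i.e. the least element of `{m − v_p(m!) : m ≥ i}`. -/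
theorem stmt_4 (p : ℕ) [Fact p.Prime] (k : Type*) [Field k] [CharP k p] [PerfectRing k p]
    (i : ℕ) (L : ℤ)
    (hL : (i = 0 ∧ L = 0) ∨ (1 ≤ i ∧
      IsLeast {v : ℤ | ∃ m : ℕ, i ≤ m ∧ v = (m : ℤ) - padicValNat p (Nat.factorial m)} L)) :
    {c : FracW p k | LaurentPolynomial.C c * T (i : ℤ) ∈ Bsub p k} =
      {c : FracW p k | ∃ w : WittVector p k,
        c = (p : FracW p k) ^ (L - (i : ℤ)) * algebraMap (WittVector p k) (FracW p k) w} := by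
  have hp0 := p_ne_zero_fracW p k
  have hex : ∃ m : ℕ, i ≤ m ∧ L = (m : ℤ) - padicValNat p (Nat.factorial m) := by
    rcases hL with ⟨rfl, rfl⟩ | ⟨-, h⟩
    · exact ⟨0, le_rfl, by simp⟩
    · exact h.1
  have hmin : ∀ m : ℕ, i ≤ m → L ≤ (m : ℤ) - padicValNat p (Nat.factorial m) := by
    intro m hm
    rcases hL with ⟨rfl, rfl⟩ | ⟨-, h⟩
    · have := padicVal_factorial_le p m
      omega
    · exact h.2 ⟨m, hm, rfl⟩
  ext c
  constructor
  · intro hc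
    obtain ⟨w, hw⟩ := coeff_form p k i L hmin _ hc
    refine ⟨w, ?_⟩
    rw [← hw, coeff_C_mul_T, if_pos rfl]
  · rintro ⟨w, rfl⟩
    obtain ⟨m, him, hLm⟩ := hex
    obtain ⟨u, hu, h⟩ := factorial_split p m
    have hu0 := unit_ne_zero_fracW p k u hu
    have h1 : LaurentPolynomial.C ((p : FracW p k)) * T (-1) ∈ Bsub p k :=
      Algebra.subset_adjoin (Or.inl rfl)
    have h2 : LaurentPolynomial.C ((Nat.factorial m : FracW p k)⁻¹) * T (m : ℤ) ∈ Bsub p k := by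
      rcases Nat.eq_zero_or_pos m with rfl | hm
      · simp
      · exact Algebra.subset_adjoin (Or.inr ⟨m, hm, rfl⟩)
    have h3 := (Bsub p k).smul_mem (mul_mem (pow_mem h1 (m - i)) h2) (u * w)
    show LaurentPolynomial.C _ * T (i : ℤ) ∈ Bsub p k
    convert h3 using 1
    have hj : (p : FracW p k) ^ (m - i) = p ^ (L - (i : ℤ)) * p ^ (padicValNat p m.factorial) := by
      simp only [← zpow_natCast]
      rw [← zpow_add₀ hp0]
      congr 1
      omega
    have hc : (p : FracW p k) ^ (L - (i : ℤ)) * algebraMap (WittVector p k) (FracW p k) w =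
        algebraMap (WittVector p k) (FracW p k) (u * w) *
          ((p : FracW p k) ^ (m - i) * (m.factorial : FracW p k)⁻¹) := by
      rw [h, hj]
      rw [map_mul, map_natCast]
      push_cast
      field_simp
    rw [hc, mul_pow, T_pow, show (i : ℤ) = ((m - i : ℕ) : ℤ) * (-1) + m by omega, T_add,
      Algebra.smul_def]
    have ha : algebraMap (WittVector p k) (LaurentPolynomial (FracW p k)) (u * w) =
      LaurentPolynomial.C (algebraMap (WittVector p k) (FracW p k) (u * w)) := rfl
    rw [ha]
    simp only [map_mul, map_pow]
    ring
end
end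

section
/- For every integer i ≤ 0, the set {c ∈ K : c·T^i ∈ B} equals p^{−i}·W(k) ⊆ K. Equivalently, the degree-i homogeneous component B^i of B is the free W(k)-module generated by v_−^{−i} = (p·T^{−1})^{−i}. -/
noncomputable section

open LaurentPolynomial

noncomputable def phiB (p : ℕ) [Fact p.Prime] (k : Type*) [Field k] [CharP k p] :
    LaurentPolynomial (WittVector p k) →ₐ[WittVector p k] LaurentPolynomial (FracW p k) :=
  AddMonoidAlgebra.lift (WittVector p k) (LaurentPolynomial (FracW p k)) ℤ
    { toFun := fun j => LaurentPolynomial.C ((p : FracW p k) ^ (-(Multiplicative.toAdd j))) *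
        T (Multiplicative.toAdd j)
      map_one' := by simp
      map_mul' := by
        intro a b
        have hp : (p : FracW p k) ≠ 0 := by
          have := (IsFractionRing.injective (WittVector p k) (FracW p k)).ne
            (WittVector.p_nonzero p k)
          simpa using this
        rw [toAdd_mul, neg_add, zpow_add₀ hp, map_mul, T_add]
        ring }

lemma fracW_p_ne (p : ℕ) [Fact p.Prime] (k : Type*) [Field k] [CharP k p] :
    (p : FracW p k) ≠ 0 := by
  have := (IsFractionRing.injective (WittVector p k) (FracW p k)).ne
    (WittVector.p_nonzero p k)
  simpa using this

lemma algMap_eq_C (p : ℕ) [Fact p.Prime] (k : Type*) [Field k] [CharP k p]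
    (w : WittVector p k) :
    algebraMap (WittVector p k) (LaurentPolynomial (FracW p k)) w =
      LaurentPolynomial.C (algebraMap (WittVector p k) (FracW p k) w) := rfl

lemma phiB_C_mul_T (p : ℕ) [Fact p.Prime] (k : Type*) [Field k] [CharP k p]
    (w : WittVector p k) (j : ℤ) :
    phiB p k (LaurentPolynomial.C w * T j) =
      LaurentPolynomial.C ((p : FracW p k) ^ (-j) * algebraMap (WittVector p k) (FracW p k) w)
        * T j := by
  rw [← LaurentPolynomial.single_eq_C_mul_T, phiB, AddMonoidAlgebra.lift_single,
    Algebra.smul_def, algMap_eq_C]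
  simp only [MonoidHom.coe_mk, OneHom.coe_mk, toAdd_ofAdd, map_mul]
  ring

lemma C_mul_T_coeff (R : Type*) [Semiring R] (c : R) (i j : ℤ) :
    (LaurentPolynomial.C c * T i : LaurentPolynomial R).coeff j = if i = j then c else 0 := by
  rw [← LaurentPolynomial.single_eq_C_mul_T]
  rw [AddMonoidAlgebra.coeff_single, Finsupp.single_apply]

lemma phiB_coeff (p : ℕ) [Fact p.Prime] (k : Type*) [Field k] [CharP k p]
    (g : LaurentPolynomial (WittVector p k)) (j : ℤ) :
    ∃ w : WittVector p k, (phiB p k g).coeff j =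
      (p : FracW p k) ^ (-j) * algebraMap (WittVector p k) (FracW p k) w := by
  induction g using LaurentPolynomial.induction_on' with
  | add f g hf hg =>
    obtain ⟨a, ha⟩ := hf
    obtain ⟨b, hb⟩ := hg
    refine ⟨a + b, ?_⟩
    rw [map_add, AddMonoidAlgebra.coeff_add, Finsupp.add_apply, ha, hb, map_add, mul_add]
  | C_mul_T n a =>
    rw [phiB_C_mul_T, C_mul_T_coeff]
    split_ifs with h
    · subst h; exact ⟨a, rfl⟩
    · exact ⟨0, by simp⟩

lemma factorial_dvd_pow (p : ℕ) [Fact p.Prime] (k : Type*) [Field k] [CharP k p] (n : ℕ) :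
    ∃ w : WittVector p k, w * (Nat.factorial n : WittVector p k) = (p : WittVector p k) ^ n := by
  have hp : p.Prime := Fact.out
  obtain ⟨e, m, hm, he⟩ := Nat.exists_eq_pow_mul_and_not_dvd (Nat.factorial_ne_zero n) p hp.ne_one
  have hen : e ≤ n := by
    have h1 : p ^ e ∣ n.factorial := ⟨m, he⟩
    have h2 := (padicValNat_dvd_iff_le (p := p) (Nat.factorial_ne_zero n)).1 h1
    have h3 := sub_one_mul_padicValNat_factorial (p := p) n
    have h4 := hp.two_le
    have h5 : 1 * padicValNat p n.factorial ≤ (p - 1) * padicValNat p n.factorial :=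
      Nat.mul_le_mul_right _ (by omega)
    omega
  have hu : IsUnit (m : WittVector p k) := by
    apply WittVector.isUnit_of_coeff_zero_ne_zero
    have : ((m : WittVector p k)).coeff 0 = (m : k) :=
      map_natCast (WittVector.constantCoeff (p := p) (R := k)) m
    rw [this]
    rwa [Ne, CharP.cast_eq_zero_iff k p]
  obtain ⟨u, hu⟩ := hu
  refine ⟨p ^ (n - e) * (↑u⁻¹ : WittVector p k), ?_⟩
  rw [he]
  push_cast
  rw [← hu]
  calc _ = (p : WittVector p k) ^ (n - e) * p ^ e * (↑u⁻¹ * (u : WittVector p k)) := by ring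
    _ = _ := by rw [Units.inv_mul, mul_one, ← pow_add, Nat.sub_add_cancel hen]

lemma Bsub_le (p : ℕ) [Fact p.Prime] (k : Type*) [Field k] [CharP k p] :
    Bsub p k ≤ (phiB p k).range := by
  have hp0 := fracW_p_ne p k
  refine Algebra.adjoin_le ?_
  rintro f (hf | ⟨n, -, rfl⟩)
  · rw [Set.mem_singleton_iff] at hf
    subst hf
    refine ⟨LaurentPolynomial.C 1 * T (-1), ?_⟩
    refine (phiB_C_mul_T p k 1 (-1)).trans ?_
    simp
  · obtain ⟨w, hw⟩ := factorial_dvd_pow p k n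
    refine ⟨LaurentPolynomial.C w * T n, ?_⟩
    refine (phiB_C_mul_T p k w n).trans ?_
    have h := congrArg (algebraMap (WittVector p k) (FracW p k)) hw
    simp only [map_mul, map_pow, map_natCast] at h
    have hn : (Nat.factorial n : FracW p k) ≠ 0 := by
      intro h0
      rw [h0, mul_zero] at h
      exact pow_ne_zero n hp0 h.symm
    congr 2
    rw [zpow_neg, zpow_natCast]
    field_simp
    exact h

/-- For every integer `i ≤ 0`, the set `{c ∈ K : c·T^i ∈ B}` equals
`p^{−i}·W(k) ⊆ K`; i.e. the degree-`i` component of `B` is the free `W(k)`-module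
generated by `v_−^{−i} = (p·T^{−1})^{−i}`. -/
theorem stmt_5 (p : ℕ) [Fact p.Prime] (k : Type*) [Field k] [CharP k p] [PerfectRing k p]
    (i : ℤ) (hi : i ≤ 0) :
    {c : FracW p k | LaurentPolynomial.C c * T i ∈ Bsub p k} =
      {c : FracW p k | ∃ w : WittVector p k,
        c = (p : FracW p k) ^ (-i) * algebraMap (WittVector p k) (FracW p k) w} := by
  ext c
  simp only [Set.mem_ofPred_eq]
  constructor
  · intro hc
    obtain ⟨g, hg⟩ := Bsub_le p k hc
    obtain ⟨w, hw⟩ := phiB_coeff p k g i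
    refine ⟨w, ?_⟩
    rw [← hw]
    have : phiB p k g = LaurentPolynomial.C c * T i := hg
    rw [this, C_mul_T_coeff, if_pos rfl]
  · rintro ⟨w, rfl⟩
    obtain ⟨n, hn⟩ := Int.eq_ofNat_of_zero_le (neg_nonneg.2 hi)
    obtain rfl : i = -(n : ℤ) := by omega
    have hgen : LaurentPolynomial.C ((p : FracW p k)) * T (-1) ∈ Bsub p k :=
      Algebra.subset_adjoin (Or.inl rfl)
    have h := (Bsub p k).smul_mem ((Bsub p k).pow_mem hgen n) w
    convert h using 1
    rw [Algebra.smul_def, algMap_eq_C, mul_pow, T_pow, neg_neg, zpow_natCast, map_mul, map_pow]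
    rw [show (n : ℤ) * -1 = -n by ring]
    ring
end
end

section
/- Let A' ⊆ K[T, T^{−1}] be the W(k)-subalgebra generated by T and p·T^{−1} (the image of A = W(k)[v_+,v_−]/(v_+v_− − p)). Then for every integer i < p one has {c ∈ K : c·T^i ∈ A'} = {c ∈ K : c·T^i ∈ B}; in particular, for 0 ≤ i ≤ p−1 this set equals W(k). That is, the inclusion A ↪ B is an isomorphism in all degrees strictly smaller than p. -/
noncomputable section

open LaurentPolynomial

/-- The `W(k)`-subalgebra `A' ⊆ K[T,T⁻¹]` generated by `T` and `p·T⁻¹`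
(the image of `A = W(k)[v₊,v₋]/(v₊v₋ − p)`). -/
def Asub (p : ℕ) [Fact p.Prime] (k : Type*) [Field k] [CharP k p] :
    Subalgebra (WittVector p k) (LaurentPolynomial (FracW p k)) :=
  Algebra.adjoin (WittVector p k)
    {T 1, LaurentPolynomial.C ((p : FracW p k)) * T (-1)}

theorem aux_val (p : ℕ) [Fact p.Prime] (m N : ℕ) (h : N < m + p) :
    padicValNat p (N.factorial) + (m - N) ≤ m := by
  have hp : 2 ≤ p := (Fact.out : p.Prime).two_le
  obtain ⟨q, rfl⟩ : ∃ q, p = q + 2 := ⟨p - 2, by omega⟩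
  have e := sub_one_mul_padicValNat_factorial (p := q + 2) N
  set v := padicValNat (q + 2) N.factorial
  have e1 : q + 2 - 1 = q + 1 := by omega
  rw [e1] at e
  rcases Nat.eq_zero_or_pos N with h0 | h0
  · subst h0
    simp [v]
  · have h2 := sub_one_mul_padicValNat_factorial_lt_of_ne_zero (q + 2) (n := N) h0.ne'
    rw [e1] at h2
    change (q + 1) * v < N at h2
    rcases le_total N m with h3 | h3
    · have : v ≤ N := by nlinarith
      omega
    · have : v ≤ m := by
        by_contra hc
        have : m + 1 ≤ v := by omega
        nlinarith [Nat.mul_le_mul_left (q + 1) this]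
      omega

theorem aux_unit (p : ℕ) [Fact p.Prime] (k : Type*) [Field k] [CharP k p] (n : ℕ) (hn : n ≠ 0) :
    ∃ u : (WittVector p k)ˣ, (n : WittVector p k) = (p : WittVector p k) ^ (padicValNat p n) * u := by
  have hp : p.Prime := Fact.out
  have h1 : p ^ padicValNat p n * (n / p ^ padicValNat p n) = n :=
    Nat.mul_div_cancel' pow_padicValNat_dvd
  have h2 : ¬ p ∣ n / p ^ padicValNat p n := by
    rw [← Nat.factorization_def n hp]
    exact Nat.not_dvd_ordCompl hp hn
  have h3 : IsUnit ((n / p ^ padicValNat p n : ℕ) : WittVector p k) := by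
    apply WittVector.isUnit_of_coeff_zero_ne_zero
    have : WittVector.constantCoeff ((n / p ^ padicValNat p n : ℕ) : WittVector p k)
      = ((n / p ^ padicValNat p n : ℕ) : k) := map_natCast _ _
    rw [← WittVector.constantCoeff_apply, this]
    intro h
    exact h2 ((CharP.cast_eq_zero_iff k p _).1 h)
  obtain ⟨u, hu⟩ := h3
  refine ⟨u, ?_⟩
  rw [hu]
  exact_mod_cast congrArg (Nat.cast : ℕ → WittVector p k) h1.symm

theorem aux_fact_ne (p : ℕ) [Fact p.Prime] (k : Type*) [Field k] [CharP k p] (n : ℕ) :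
    (n.factorial : FracW p k) ≠ 0 := by
  obtain ⟨u, hu⟩ := aux_unit p k n.factorial n.factorial_ne_zero
  have : (n.factorial : WittVector p k) ≠ 0 := by
    rw [hu]
    exact mul_ne_zero (pow_ne_zero _ (WittVector.p_nonzero p k)) u.ne_zero
  rw [← map_natCast (algebraMap (WittVector p k) (FracW p k))]
  intro h
  exact this ((IsFractionRing.injective (WittVector p k) (FracW p k)) (h.trans (map_zero _).symm))

/-- the spanning monomials of `B` -/
def auxGen (p : ℕ) [Fact p.Prime] (k : Type*) [Field k] [CharP k p] (m N : ℕ) :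
    LaurentPolynomial (FracW p k) :=
  LaurentPolynomial.C ((p : FracW p k) ^ m * (Nat.factorial N : FracW p k)⁻¹) * T ((N : ℤ) - m)

theorem aux_smul (p : ℕ) [Fact p.Prime] (k : Type*) [Field k] [CharP k p] (w : WittVector p k)
    (f : LaurentPolynomial (FracW p k)) :
    w • f = LaurentPolynomial.C (algebraMap (WittVector p k) (FracW p k) w) * f := by
  rw [← LaurentPolynomial.smul_eq_C_mul, algebraMap_smul]

theorem aux_mul (p : ℕ) [Fact p.Prime] (k : Type*) [Field k] [CharP k p] (m N m' N' : ℕ) :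
    auxGen p k m N * auxGen p k m' N' =
      ((N + N').choose N : WittVector p k) • auxGen p k (m + m') (N + N') := by
  rw [aux_smul]
  unfold auxGen
  have h : ((N + N').factorial : FracW p k) =
      ((N + N').choose N : FracW p k) * N.factorial * N'.factorial := by
    have := Nat.add_choose_mul_factorial_mul_factorial N N'
    rw [Nat.choose_symm_add] at *
    rw [← this]
    push_cast
    rfl
  have e : ((p : FracW p k) ^ m * (Nat.factorial N : FracW p k)⁻¹) *
      ((p : FracW p k) ^ m' * (Nat.factorial N' : FracW p k)⁻¹) =
      ((N + N').choose N : FracW p k) *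
        ((p : FracW p k) ^ (m + m') * (Nat.factorial (N + N') : FracW p k)⁻¹) := by
    have h1 := aux_fact_ne p k N
    have h2 := aux_fact_ne p k N'
    have h3 := aux_fact_ne p k (N + N')
    field_simp
    rw [h]
    ring
  have t : ((N : ℤ) - m) + ((N' : ℤ) - m') = ((N + N' : ℕ) : ℤ) - ((m + m' : ℕ) : ℤ) := by
    push_cast; ring
  rw [map_natCast, ← mul_assoc (LaurentPolynomial.C ((N + N').choose N : FracW p k)),
    ← map_mul LaurentPolynomial.C ((N + N').choose N : FracW p k), ← e, ← t, T_add]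
  simp only [map_mul]
  ring

theorem aux_B_le (p : ℕ) [Fact p.Prime] (k : Type*) [Field k] [CharP k p]
    (f : LaurentPolynomial (FracW p k)) (hf : f ∈ Bsub p k) :
    f ∈ Submodule.span (WittVector p k) (Set.range fun x : ℕ × ℕ => auxGen p k x.1 x.2) := by
  have hg : ∀ m N, auxGen p k m N ∈
      Submodule.span (WittVector p k) (Set.range fun x : ℕ × ℕ => auxGen p k x.1 x.2) :=
    fun m N => Submodule.subset_span ⟨(m, N), rfl⟩
  unfold Bsub at hf
  induction hf using Algebra.adjoin_induction with
  | mem x hx =>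
    rcases hx with hx | ⟨n, hn, hx⟩
    · rw [Set.mem_singleton_iff] at hx
      have := hg 1 0
      rw [hx]
      simpa [auxGen] using this
    · have := hg 0 n
      rw [hx]
      simpa [auxGen] using this
  | algebraMap r =>
    rw [Algebra.algebraMap_eq_smul_one]
    have h1 : (1 : LaurentPolynomial (FracW p k)) = auxGen p k 0 0 := by simp [auxGen]
    rw [h1]
    exact Submodule.smul_mem _ _ (hg 0 0)
  | add x y _ _ hx hy => exact Submodule.add_mem _ hx hy
  | mul x y _ _ hx hy =>
    have h := Submodule.mul_mem_mul hx hy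
    rw [Submodule.span_mul_span] at h
    refine Submodule.span_le.2 ?_ h
    rintro _ ⟨_, ⟨a, rfl⟩, _, ⟨b, rfl⟩, rfl⟩
    change auxGen p k a.1 a.2 * auxGen p k b.1 b.2 ∈ Submodule.span _ _
    rw [aux_mul]
    exact Submodule.smul_mem _ _ (hg _ _)

theorem aux_coeff (p : ℕ) [Fact p.Prime] (k : Type*) [Field k] [CharP k p]
    (c : FracW p k) (i j : ℤ) :
    (LaurentPolynomial.C c * T i : LaurentPolynomial (FracW p k)).coeff j
      = if i = j then c else 0 := by
  rw [← single_eq_C_mul_T]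
  exact Finsupp.single_apply

theorem aux_B_coeff (p : ℕ) [Fact p.Prime] (k : Type*) [Field k] [CharP k p]
    (f : LaurentPolynomial (FracW p k)) (hf : f ∈ Bsub p k) (i : ℤ) (hi : i < p) :
    ∃ w : WittVector p k, f.coeff i =
      algebraMap (WittVector p k) (FracW p k) (w * (p : WittVector p k) ^ (-i).toNat) := by
  have h := aux_B_le p k f hf
  clear hf
  induction h using Submodule.span_induction with
  | mem x hx =>
    obtain ⟨⟨m, N⟩, rfl⟩ := hx
    simp only [auxGen]
    rw [aux_coeff]
    split_ifs with hij
    · subst hij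
      obtain ⟨u, hu⟩ := aux_unit p k N.factorial N.factorial_ne_zero
      have hv := aux_val p m N (by omega)
      have ht : (-((N : ℤ) - m)).toNat = m - N := by omega
      rw [ht]
      set v := padicValNat p N.factorial
      refine ⟨(p : WittVector p k) ^ (m - v - (m - N)) * (u⁻¹ : (WittVector p k)ˣ), ?_⟩
      have h1 := aux_fact_ne p k N
      rw [← div_eq_mul_inv, div_eq_iff h1,
        ← map_natCast (algebraMap (WittVector p k) (FracW p k)) N.factorial, ← map_mul, hu,
        ← map_natCast (algebraMap (WittVector p k) (FracW p k)) p, ← map_pow]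
      congr 1
      have hm : m = (m - v - (m - N)) + (m - N) + v := by omega
      calc (p : WittVector p k) ^ m = (p : WittVector p k) ^ ((m - v - (m - N)) + (m - N) + v) := by
            rw [← hm]
        _ = (p : WittVector p k) ^ (m - v - (m - N)) * (p : WittVector p k) ^ (m - N)
              * (p : WittVector p k) ^ v * ((u⁻¹ : (WittVector p k)ˣ) * u) := by
            rw [Units.inv_mul, pow_add, pow_add, mul_one]
        _ = _ := by ring
    · exact ⟨0, by simp⟩
  | zero => exact ⟨0, by simp⟩
  | add x y _ _ hx hy =>
    obtain ⟨a, ha⟩ := hx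
    obtain ⟨b, hb⟩ := hy
    refine ⟨a + b, ?_⟩
    rw [add_mul, map_add, ← ha, ← hb]
    rfl
  | smul a x _ hx =>
    obtain ⟨b, hb⟩ := hx
    refine ⟨a * b, ?_⟩
    rw [mul_assoc, map_mul, ← hb, ← Algebra.smul_def]
    rfl

theorem aux_A_le_B (p : ℕ) [Fact p.Prime] (k : Type*) [Field k] [CharP k p] :
    Asub p k ≤ Bsub p k := by
  unfold Asub
  rw [Algebra.adjoin_le_iff]
  rintro x (hx | hx)
  · apply Algebra.subset_adjoin
    right
    exact ⟨1, le_rfl, by simp [hx]⟩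
  · apply Algebra.subset_adjoin
    left
    exact hx

theorem aux_mem_A (p : ℕ) [Fact p.Prime] (k : Type*) [Field k] [CharP k p]
    (w : WittVector p k) (i : ℤ) :
    LaurentPolynomial.C (algebraMap (WittVector p k) (FracW p k)
      (w * (p : WittVector p k) ^ (-i).toNat)) * T i ∈ Asub p k := by
  have hT : (T 1 : LaurentPolynomial (FracW p k)) ∈ Asub p k :=
    Algebra.subset_adjoin (by simp)
  have hP : (LaurentPolynomial.C ((p : FracW p k)) * T (-1)) ∈ Asub p k :=
    Algebra.subset_adjoin (by simp)
  have e : LaurentPolynomial.C (algebraMap (WittVector p k) (FracW p k)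
      (w * (p : WittVector p k) ^ (-i).toNat)) * T i =
      w • ((LaurentPolynomial.C ((p : FracW p k)) * T (-1)) ^ (-i).toNat * (T 1) ^ i.toNat) := by
    have ht : i = ((-i).toNat : ℤ) * (-1) + (i.toNat : ℤ) * 1 := by omega
    rw [aux_smul, mul_pow, T_pow, T_pow, mul_assoc (LaurentPolynomial.C _ ^ _), ← T_add, ← ht]
    simp only [map_mul, map_pow, map_natCast]
    ring
  rw [e]
  exact Subalgebra.smul_mem _ (mul_mem (pow_mem hP _) (pow_mem hT _)) w

/-- For every integer `i < p` one has
`{c ∈ K : c·T^i ∈ A'} = {c ∈ K : c·T^i ∈ B}`; in particular, for `0 ≤ i ≤ p−1`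
this set equals `W(k)`. That is, `A ↪ B` is an isomorphism in degrees `< p`. -/
theorem stmt_6 (p : ℕ) [Fact p.Prime] (k : Type*) [Field k] [CharP k p] [PerfectRing k p] :
    (∀ i : ℤ, i < (p : ℤ) →
      {c : FracW p k | LaurentPolynomial.C c * T i ∈ Asub p k} =
        {c : FracW p k | LaurentPolynomial.C c * T i ∈ Bsub p k}) ∧
    (∀ i : ℤ, 0 ≤ i → i ≤ (p : ℤ) - 1 →
      {c : FracW p k | LaurentPolynomial.C c * T i ∈ Asub p k} =
        Set.range (algebraMap (WittVector p k) (FracW p k))) := by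
  have key : ∀ (i : ℤ), i < p → ∀ c : FracW p k, LaurentPolynomial.C c * T i ∈ Bsub p k →
      ∃ w : WittVector p k, c =
        algebraMap (WittVector p k) (FracW p k) (w * (p : WittVector p k) ^ (-i).toNat) := by
    intro i hi c hc
    obtain ⟨w, hw⟩ := aux_B_coeff p k _ hc i hi
    rw [aux_coeff, if_pos rfl] at hw
    exact ⟨w, hw⟩
  constructor
  · intro i hi
    ext c
    constructor
    · intro hc
      exact aux_A_le_B p k hc
    · intro hc
      obtain ⟨w, rfl⟩ := key i hi c hc
      exact aux_mem_A p k w i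
  · intro i h0 hi
    ext c
    have ht : (-i).toNat = 0 := by omega
    constructor
    · intro hc
      obtain ⟨w, rfl⟩ := key i (by omega) c (aux_A_le_B p k hc)
      exact ⟨_, rfl⟩
    · rintro ⟨w, rfl⟩
      have := aux_mem_A p k w i
      rw [ht, pow_zero, mul_one] at this
      exact this
end
end

section
/- Let (M, φ) be a Fontaine–Laffaille module over W(k): M is a finitely generated ℤ-graded W[v]-module and φ: M/(v−p)M → M/(v−1)M is a σ-semilinear bijection. Then for every a ∈ W, multiplication by v − a on M is injective. In particular multiplication by v is injective, i.e., each map v: F^i → F^{i−1} between the graded pieces is injective. (Equivalently, for every point v = a the derived fiber of M is concentrated in cohomological degree 0.) -/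
/-- first helper: length of kernel + range -/
lemma fl_len {A P Q : Type*} [Ring A] [AddCommGroup P] [Module A P] [AddCommGroup Q] [Module A Q]
    (f : P →ₗ[A] Q) : Module.length A P =
      Module.length A (LinearMap.ker f) + Module.length A (LinearMap.range f) :=
  Module.length_eq_add_of_exact (LinearMap.ker f).subtype f.rangeRestrict
    (Submodule.subtype_injective _) f.surjective_rangeRestrict
    (by intro x; simp [Subtype.ext_iff])

lemma fl_key {A N : Type*} [CommRing A] [AddCommGroup N] [Module A N] (V : N →ₗ[A] N)
    (G : ℕ → Submodule A N) (hG : ∀ d, G (d + 1) = G d ⊔ (G d).map V)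
    (hex : ∀ x, ∃ d, x ∈ G d) (hfin : ∀ d, IsFiniteLength A (G d)) (a b : A)
    (hb : Function.Injective (V - algebraMap A (Module.End A N) b))
    (hlen : Module.length A (N ⧸ LinearMap.range (V - algebraMap A (Module.End A N) a)) ≤
      Module.length A (N ⧸ LinearMap.range (V - algebraMap A (Module.End A N) b))) :
    Function.Injective (V - algebraMap A (Module.End A N) a) := by
  have hmono : Monotone G := monotone_nat_of_le_succ fun d => by rw [hG]; exact le_sup_left
  have hV : ∀ d x, x ∈ G d → V x ∈ G (d + 1) := fun d x hx => by
    rw [hG]; exact Submodule.mem_sup_right ⟨x, hx, rfl⟩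
  have hVc : ∀ c d x, x ∈ G d → (V - algebraMap A (Module.End A N) c) x ∈ G (d + 1) := by
    intro c d x hx
    simp only [LinearMap.sub_apply, Module.algebraMap_end_apply]
    exact sub_mem (hV d x hx) (Submodule.smul_mem _ _ (hmono (Nat.le_succ d) hx))
  have h1 : ∀ d, ∃ n : ℕ, Module.length A (G d) = n := fun d => by
    have := Module.length_ne_top_iff.mpr (hfin d)
    exact ⟨_, (ENat.natCast_toNat this).symm⟩
  choose g hg using h1
  -- the submodule of `x` in `G (d+1)` with `V x` in `G (d+1)`
  let P : ℕ → Submodule A N := fun d => G (d + 1) ⊓ (G (d + 1)).comap V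
  have hGP : ∀ d, G d ≤ P d := fun d x hx => ⟨hmono (Nat.le_succ d) hx, hV d x hx⟩
  have hgmono : ∀ d, g d ≤ g (d + 1) := fun d => by
    have := Module.length_le_of_injective (Submodule.inclusion (hmono (Nat.le_succ d)))
      (Submodule.inclusion_injective _)
    rw [hg, hg] at this
    exact_mod_cast this
  have hP : ∀ d, Module.length A (P d) + g (d + 2) = g (d + 1) + g (d + 1) := by
    intro d
    let f : G (d + 1) →ₗ[A] (N ⧸ G (d + 1)) := (G (d + 1)).mkQ ∘ₗ V ∘ₗ (G (d + 1)).subtype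
    let h : G (d + 2) →ₗ[A] (N ⧸ G (d + 1)) := (G (d + 1)).mkQ ∘ₗ (G (d + 2)).subtype
    have hr : LinearMap.range f = LinearMap.range h := by
      apply le_antisymm
      · rintro _ ⟨x, rfl⟩
        exact ⟨⟨V x, hV _ _ x.2⟩, rfl⟩
      · rintro _ ⟨⟨x, hx⟩, rfl⟩
        rw [hG, Submodule.mem_sup] at hx
        obtain ⟨y, hy, _, ⟨z, hz, rfl⟩, rfl⟩ := hx
        refine ⟨⟨z, hz⟩, ?_⟩
        simp only [f, h, LinearMap.comp_apply, Submodule.subtype_apply, map_add]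
        rw [(Submodule.Quotient.mk_eq_zero _).mpr hy |> (show (G (d+1)).mkQ y = 0 from ·), zero_add]
    have e1 : Module.length A (LinearMap.ker f) = Module.length A (P d) := by
      rw [LinearEquiv.length_eq (Submodule.equivSubtypeMap (G (d+1)) (LinearMap.ker f))]
      have : (LinearMap.ker f).map (G (d+1)).subtype = P d := by
        ext x
        simp [f, P, and_comm]
      rw [this]
    have e2 : Module.length A (LinearMap.ker h) = g (d + 1) := by
      rw [LinearEquiv.length_eq (Submodule.equivSubtypeMap (G (d+2)) (LinearMap.ker h)), ← hg]
      have : (LinearMap.ker h).map (G (d+2)).subtype = G (d + 1) := by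
        ext x
        simp only [h, Submodule.mem_map, LinearMap.mem_ker, LinearMap.comp_apply,
          Submodule.subtype_apply, Submodule.mkQ_apply, Submodule.Quotient.mk_eq_zero]
        exact ⟨by rintro ⟨y, hy, rfl⟩; exact hy, fun hx => ⟨⟨x, hmono (Nat.le_succ _) hx⟩, hx, rfl⟩⟩
      rw [this]
    have l1 := fl_len f
    have l2 := fl_len h
    rw [e1, hg, hr] at l1
    rw [e2, hg] at l2
    calc _ = (g (d + 1) : ℕ∞) + (Module.length A (P d) + Module.length A (LinearMap.range h)) := by
          rw [l2]; ring
      _ = _ := by rw [← l1]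
  have hPge : ∀ d, g d ≤ Module.length A (P d) := fun d => by
    have := Module.length_le_of_injective (Submodule.inclusion (hGP d))
      (Submodule.inclusion_injective _)
    rwa [hg] at this
  have hPfin : ∀ d, IsFiniteLength A (P d) := fun d =>
    (hfin (d + 1)).of_injective (f := Submodule.inclusion inf_le_left)
      (Submodule.inclusion_injective _)
  have hdec : ∀ d, g (d + 2) - g (d + 1) ≤ g (d + 1) - g d := by
    intro d
    have h1 := hP d
    have h2 := hPge d
    obtain ⟨n, hn⟩ := ENat.ne_top_iff_exists.mp (Module.length_ne_top_iff.mpr (hPfin d))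
    rw [← hn] at h1 h2
    norm_cast at h1 h2
    omega
  obtain ⟨D, hD⟩ : ∃ D, ∀ d ≥ D, g (d + 2) - g (d + 1) = g (d + 1) - g d := by
    obtain ⟨D, hD⟩ := WellFoundedLT.antitone_chain_condition (α := ℕ)
      (f := fun d => g (d + 1) - g d) (antitone_nat_of_succ_le fun d => hdec d)
    refine ⟨D, fun d hd => ?_⟩
    have h1 := hD d hd
    have h2 := hD (d + 1) (by omega)
    exact h2.symm.trans h1
  have hPeq : ∀ d ≥ D, P d = G d := by
    intro d hd
    have h1 := hP d
    have h2 := hD d hd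
    have h3 := hgmono d
    have h4 : g (d + 1) ≤ g (d + 2) := hgmono (d + 1)
    obtain ⟨n, hn⟩ := ENat.ne_top_iff_exists.mp (Module.length_ne_top_iff.mpr (hPfin d))
    rw [← hn] at h1
    norm_cast at h1
    have hng : n = g d := by omega
    by_contra hne
    have := (isFiniteLength_iff_isNoetherian_isArtinian.mp (hPfin d)).1
    have := (isFiniteLength_iff_isNoetherian_isArtinian.mp (hPfin d)).2
    have hlt := Submodule.length_lt (M := P d) (N := (G d).submoduleOf (P d)) (by
      rw [Ne, Submodule.submoduleOf_eq_top]
      exact fun h => hne (le_antisymm h (hGP d)))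
    rw [LinearEquiv.length_eq (Submodule.submoduleOfEquivOfLe (hGP d)), hg, ← hn, hng] at hlt
    exact lt_irrefl _ hlt
  have hback : ∀ d ≥ D, ∀ x, (V - algebraMap A (Module.End A N) a) x ∈ G (d + 1) → x ∈ G d := by
    intro d hd x hx
    obtain ⟨e, he⟩ := hex x
    induction e with
    | zero => exact hmono (Nat.zero_le d) he
    | succ e ih =>
      rcases Nat.lt_or_ge d (e + 1) with hlt | hge
      · apply ih
        rw [← hPeq e (by omega)]
        refine ⟨he, ?_⟩
        have h5 := hmono (show d + 1 ≤ e + 1 by omega) hx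
        have h6 := add_mem h5 (Submodule.smul_mem _ a he)
        simpa [Module.algebraMap_end_apply] using h6
      · exact hmono hge he
  have hlower : ∀ d ≥ D, (g (d + 1) : ℕ∞) +
      Module.length A ↥(G d ⊓ LinearMap.ker (V - algebraMap A (Module.End A N) a)) ≤
      g d + Module.length A (N ⧸ LinearMap.range (V - algebraMap A (Module.End A N) a)) := by
    intro d hd
    set F := V - algebraMap A (Module.End A N) a
    let q : G (d + 1) →ₗ[A] (N ⧸ LinearMap.range F) :=
      (LinearMap.range F).mkQ ∘ₗ (G (d + 1)).subtype
    let r : G d →ₗ[A] N := F ∘ₗ (G d).subtype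
    have e1 : Module.length A (LinearMap.ker q) = Module.length A (LinearMap.range r) := by
      rw [LinearEquiv.length_eq (Submodule.equivSubtypeMap (G (d+1)) (LinearMap.ker q))]
      have : (LinearMap.ker q).map (G (d+1)).subtype = LinearMap.range r := by
        ext x
        simp only [q, r, Submodule.mem_map, LinearMap.mem_ker, LinearMap.comp_apply,
          Submodule.subtype_apply, Submodule.mkQ_apply, Submodule.Quotient.mk_eq_zero]
        constructor
        · rintro ⟨⟨y, hy⟩, ⟨z, rfl⟩, rfl⟩
          exact ⟨⟨z, hback d hd z hy⟩, rfl⟩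
        · rintro ⟨⟨z, hz⟩, rfl⟩
          exact ⟨⟨F z, hVc a d z hz⟩, ⟨z, rfl⟩, rfl⟩
      rw [this]
    have e2 : Module.length A (LinearMap.ker r) = Module.length A ↥(G d ⊓ LinearMap.ker F) := by
      rw [LinearEquiv.length_eq (Submodule.equivSubtypeMap (G d) (LinearMap.ker r))]
      have : (LinearMap.ker r).map (G d).subtype = G d ⊓ LinearMap.ker F := by
        ext x
        simp [r, and_comm]
      rw [this]
    have l1 := fl_len q
    have l2 := fl_len r
    rw [hg, e1] at l1
    rw [hg, e2] at l2
    rw [l1, l2]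
    have h3 := Module.length_le_of_injective (LinearMap.range q).subtype
      (Submodule.subtype_injective _)
    calc _ = Module.length A ↥(G d ⊓ LinearMap.ker F) + Module.length A (LinearMap.range r) +
          Module.length A (LinearMap.range q) := by ring
      _ ≤ _ := by gcongr
  have hupper : ∀ d, (g d : ℕ∞) +
      Module.length A (N ⧸ LinearMap.range (V - algebraMap A (Module.End A N) b)) ≤ g (d + 1) := by
    intro d
    set F := V - algebraMap A (Module.End A N) b with hF
    let q : G (d + 1) →ₗ[A] (N ⧸ LinearMap.range F) :=
      (LinearMap.range F).mkQ ∘ₗ (G (d + 1)).subtype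
    have hstep : ∀ e, G (e + 1) ≤ G e ⊔ LinearMap.range F := by
      intro e
      rw [hG]
      refine sup_le le_sup_left ?_
      rintro _ ⟨x, hx, rfl⟩
      have : V x = b • x + F x := by simp [hF, Module.algebraMap_end_apply]
      rw [this]
      exact Submodule.add_mem_sup (Submodule.smul_mem _ _ hx) ⟨x, rfl⟩
    have hall : ∀ e, G e ≤ G 0 ⊔ LinearMap.range F := by
      intro e
      induction e with
      | zero => exact le_sup_left
      | succ e ih => exact (hstep e).trans (sup_le ih le_sup_right)
    have hq : Function.Surjective q := by
      intro y
      obtain ⟨x, rfl⟩ := Submodule.mkQ_surjective _ y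
      obtain ⟨e, he⟩ := hex x
      obtain ⟨u, hu, w, hw, rfl⟩ := Submodule.mem_sup.mp (hall e he)
      refine ⟨⟨u, hmono (Nat.zero_le _) hu⟩, ?_⟩
      simp only [q, LinearMap.comp_apply, Submodule.subtype_apply, map_add]
      rw [show (LinearMap.range F).mkQ w = 0 from (Submodule.Quotient.mk_eq_zero _).mpr hw,
        add_zero]
    let s : G d →ₗ[A] LinearMap.ker q :=
      (F.restrict (p := G d) (q := G (d + 1)) (hVc b d)).codRestrict _ (by
        intro x
        simp only [q, LinearMap.mem_ker, LinearMap.comp_apply, Submodule.subtype_apply,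
          Submodule.mkQ_apply, Submodule.Quotient.mk_eq_zero]
        exact ⟨x, rfl⟩)
    have hs : Function.Injective s := by
      intro x y hxy
      apply Subtype.ext
      apply hb
      exact congrArg (fun z : LinearMap.ker q => ((z : G (d + 1)) : N)) hxy
    have l1 := fl_len q
    rw [hg, LinearMap.range_eq_top.mpr hq, Module.length_top] at l1
    rw [l1, ← hg]
    gcongr
    exact Module.length_le_of_injective s hs
  rw [← LinearMap.ker_eq_bot, eq_bot_iff]
  intro x hx
  obtain ⟨e, he⟩ := hex x
  have hx' := hmono (le_max_left e D) he
  have h1 := hlower _ (le_max_right e D)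
  have h2 := hupper (max e D)
  have h3 := h1.trans ((add_le_add_right hlen _).trans h2)
  have h4 : Module.length A ↥(G (max e D) ⊓ LinearMap.ker (V - algebraMap A (Module.End A N) a)) = 0 := by
    by_contra hne
    have h5 := ENat.add_one_le_iff (ENat.natCast_ne_top (g (max e D + 1))) |>.mp
      ((add_le_add_right (Order.one_le_iff_pos.mpr (pos_iff_ne_zero.mpr hne)) _).trans h3)
    exact lt_irrefl _ h5
  rw [Module.length_eq_zero_iff] at h4
  have := congrArg Subtype.val (h4.elim ⟨x, hx', hx⟩ 0)
  simpa using this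

section
open Polynomial

/-- comparison of lengths along a semilinear surjection -/
lemma fl_semilin {A P Q₁ Q₂ : Type*} [CommRing A] (σ : A →+* A) [RingHomSurjective σ]
    [AddCommGroup P] [Module A P] [AddCommGroup Q₁] [Module A Q₁] [AddCommGroup Q₂] [Module A Q₂]
    (ψ : P →ₛₗ[σ] Q₁) (ρ : P →ₗ[A] Q₂) (hρ : Function.Surjective ρ)
    (hk : ∀ x, ψ x = 0 → ρ x = 0) : Module.length A Q₂ ≤ Module.length A Q₁ := by
  rw [← WithBot.coe_le_coe, Module.coe_length, Module.coe_length]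
  refine Order.krullDim_le_of_strictMono (fun S => (S.comap ρ).map ψ) ?_
  refine Monotone.strictMono_of_injective ?_ ?_
  · intro S T h
    exact Submodule.map_mono (Submodule.comap_mono h)
  · intro S T h
    have h1 : ∀ S : Submodule A Q₂, ((S.comap ρ).map ψ).comap ψ = S.comap ρ := by
      intro S
      rw [Submodule.comap_map_eq, sup_eq_left]
      intro x hx
      rw [Submodule.mem_comap, hk x hx]
      exact S.zero_mem
    apply Submodule.comap_injective_of_surjective hρ
    rw [← h1 S, ← h1 T]
    exact congrArg (Submodule.comap ψ) h

lemma fl_graded {A M : Type*} [CommRing A] [AddCommGroup M] [Module A M] [Module A[X] M]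
    [IsScalarTower A A[X] M] (ℱ : ℤ → Submodule A M) (hint : DirectSum.IsInternal ℱ)
    (hdeg : ∀ i : ℤ, ∀ x ∈ ℱ i, (X : A[X]) • x ∈ ℱ (i - 1)) (c : A) (f : A[X])
    (hf : IsUnit (f.coeff 0)) (x : M) (hx : ∃ y, f • x = c • y) : ∃ y, x = c • y := by
  classical
  let _ := hint.chooseDecomposition
  let π : ℤ → M →ₗ[A] M := fun i =>
    (ℱ i).subtype ∘ₗ DirectSum.component A ℤ (fun i => ℱ i) i ∘ₗ
      (DirectSum.decomposeLinearEquiv ℱ).toLinearMap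
  have hπ : ∀ i x, π i x = (DirectSum.decompose ℱ x i : M) := fun i x => rfl
  have hXπ : ∀ i x, π i ((X : A[X]) • x) = (X : A[X]) • π (i + 1) x := by
    intro i x
    induction x using DirectSum.Decomposition.inductionOn ℱ with
    | zero => simp
    | @homogeneous j m =>
      rw [hπ, hπ]
      by_cases h : j = i + 1
      · subst h
        have := hdeg _ _ m.2
        rw [add_sub_cancel_right] at this
        rw [DirectSum.decompose_of_mem_same _ this, DirectSum.decompose_of_mem_same _ m.2]
      · rw [DirectSum.decompose_of_mem_ne _ (hdeg _ _ m.2) (by omega),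
          DirectSum.decompose_of_mem_ne _ m.2 h, smul_zero]
    | add a b ha hb => simp only [smul_add, map_add, ha, hb]
  let Q : Submodule A M := LinearMap.range (LinearMap.lsmul A M c)
  have hQ : ∀ z, z ∈ Q ↔ ∃ y, z = c • y := fun z =>
    ⟨fun ⟨y, hy⟩ => ⟨y, hy.symm⟩, fun ⟨y, hy⟩ => ⟨y, hy.symm⟩⟩
  have hQπ : ∀ i z, z ∈ Q → π i z ∈ Q := by
    rintro i _ ⟨y, rfl⟩
    exact ⟨π i y, by simp⟩
  have hQX : ∀ z, z ∈ Q → (X : A[X]) • z ∈ Q := by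
    rintro _ ⟨y, rfl⟩
    exact ⟨(X : A[X]) • y, by
      simp only [LinearMap.lsmul_apply]
      exact smul_comm _ _ _⟩
  have hsum : ∀ z, (∀ i, π i z ∈ Q) → z ∈ Q := by
    intro z hz
    rw [← DirectSum.sum_support_decompose ℱ z]
    exact sum_mem fun i _ => hz i
  have hpoly : ∀ (h : A[X]) (m : ℤ) (z : M), (∀ i ≥ m, π i z ∈ Q) → ∀ i ≥ m, π i (h • z) ∈ Q := by
    intro h
    induction h using Polynomial.induction_on' with
    | add a b ha hb =>
      intro m z hz i hi
      rw [add_smul, map_add]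
      exact add_mem (ha m z hz i hi) (hb m z hz i hi)
    | monomial n a =>
      intro m z hz
      rw [← C_mul_X_pow_eq_monomial]
      have key : ∀ n : ℕ, ∀ i ≥ m, π i ((X : A[X]) ^ n • z) ∈ Q := by
        intro n
        induction n with
        | zero => simpa using hz
        | succ n ih =>
          intro i hi
          rw [pow_succ', mul_smul, hXπ]
          exact hQX _ (ih _ (by omega))
      intro i hi
      rw [mul_smul, ← Polynomial.algebraMap_eq, algebraMap_smul, map_smul]
      exact Q.smul_mem _ (key n i hi)
  rw [← hQ] at hx ⊢
  apply hsum
  obtain ⟨B, hB⟩ : ∃ B : ℤ, ∀ i ≥ B, π i x ∈ Q := by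
    obtain ⟨B, hB⟩ := (DirectSum.decompose ℱ x).support.bddAbove
    refine ⟨B + 1, fun i hi => ?_⟩
    have : i ∉ (DirectSum.decompose ℱ x).support := fun h => by
      have := hB (Finset.mem_coe.mpr h)
      omega
    rw [DFinsupp.notMem_support_iff] at this
    rw [hπ, this]
    exact Q.zero_mem
  have hdown : ∀ n : ℕ, ∀ i ≥ B - n, π i x ∈ Q := by
    intro n
    induction n with
    | zero => simpa using hB
    | succ n ih =>
      intro i hi
      rcases eq_or_lt_of_le hi with h | h
      · have h1 := hQπ i _ hx
        have h2 : f • x = (X : A[X]) • (f.divX • x) + f.coeff 0 • x := by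
          conv_lhs => rw [← f.X_mul_divX_add]
          rw [add_smul, mul_smul, ← Polynomial.algebraMap_eq, algebraMap_smul]
        rw [h2, map_add, hXπ, (π i).map_smul] at h1
        have h3 := hQX _ (hpoly f.divX _ x ih (i + 1) (by push_cast at h; omega))
        have h4 := (Submodule.add_mem_iff_right _ h3).mp h1
        obtain ⟨u, hu⟩ := hf
        have h5 := Q.smul_mem (↑u⁻¹ : A) h4
        rwa [← hu, smul_smul, Units.inv_mul, one_smul] at h5
      · exact ih i (by push_cast at h; omega)
  intro i
  exact hdown (B - i).toNat i (by omega)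

lemma fl_finlen {A N : Type*} [CommRing A] [IsDomain A] [IsNoetherianRing A] [Ring.KrullDimLE 1 A]
    [AddCommGroup N] [Module A N] (c : A) (hc : c ≠ 0) (hN : ∀ x : N, c • x = 0)
    (s : Finset N) : IsFiniteLength A (Submodule.span A (s : Set N)) := by
  classical
  rw [isFiniteLength_iff_isNoetherian_isArtinian]
  refine ⟨isNoetherian_span_of_finite A s.finite_toSet, ?_⟩
  induction s using Finset.induction_on with
  | empty => rw [Finset.coe_empty, Submodule.span_empty]; infer_instance
  | insert x s _ ih =>
    rw [Finset.coe_insert, Submodule.span_insert]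
    have h1 := isFiniteLength_quotient_span_singleton A (mem_nonZeroDivisors_of_ne_zero hc)
    have h2 := (isFiniteLength_iff_isNoetherian_isArtinian.mp h1).2
    have : IsArtinian A (Submodule.span A {x}) := by
      let f : (A ⧸ Ideal.span {c}) →ₗ[A] N :=
        Submodule.liftQ (Ideal.span {c}) (LinearMap.toSpanSingleton A N x) (by
          rw [Ideal.span, Submodule.span_le, Set.singleton_subset_iff]
          simp [hN])
      have hf : Submodule.span A {x} = LinearMap.range f := by
        rw [Submodule.range_liftQ, LinearMap.range_toSpanSingleton]
      rw [hf]
      infer_instance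
    infer_instance

lemma fl_rho {A M : Type*} [CommRing A] [AddCommGroup M] [Module A M] [Module A[X] M]
    [IsScalarTower A A[X] M] (a c : A) (S : Submodule A[X] M) (hS : ∀ x, x ∈ S ↔ ∃ y, x = c • y) :
    ∃ ρ : (M ⧸ (Ideal.span {X - C a} • (⊤ : Submodule A[X] M))) →ₗ[A]
      ((M ⧸ S) ⧸ LinearMap.range (Algebra.lsmul A A (M ⧸ S) (X : A[X]) -
        algebraMap A (Module.End A (M ⧸ S)) a)),
      Function.Surjective ρ ∧ ∀ z, ρ z = 0 ↔ ∃ y, z = c • y := by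
  set F := Algebra.lsmul A A (M ⧸ S) (X : A[X]) - algebraMap A (Module.End A (M ⧸ S)) a with hF
  set T := Ideal.span {X - C a} • (⊤ : Submodule A[X] M) with hT
  have hTm : ∀ x, x ∈ T ↔ ∃ y, x = (X - C a) • y := by
    intro x
    rw [hT, Submodule.ideal_span_singleton_smul, Submodule.mem_smul_pointwise_iff_exists]
    simp [eq_comm]
  have hFm : ∀ y : M, F (S.mkQ y) = S.mkQ ((X - C a) • y) := by
    intro y
    simp only [hF, LinearMap.sub_apply, Module.algebraMap_end_apply, Algebra.lsmul_coe,
      sub_smul]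
    rw [← Polynomial.algebraMap_eq, algebraMap_smul]
    rfl
  let g : M →ₗ[A] ((M ⧸ S) ⧸ LinearMap.range F) :=
    (LinearMap.range F).mkQ ∘ₗ S.mkQ.restrictScalars A
  have hg0 : ∀ x, g x = 0 ↔ ∃ y, S.mkQ x = F y := by
    intro x
    change (LinearMap.range F).mkQ (S.mkQ x) = 0 ↔ _
    rw [Submodule.mkQ_apply, Submodule.Quotient.mk_eq_zero, LinearMap.mem_range]
    simp [eq_comm]
  have hgs : Function.Surjective g :=
    (Submodule.mkQ_surjective _).comp (Submodule.mkQ_surjective S)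
  let ρ' : (M ⧸ T.restrictScalars A) →ₗ[A] ((M ⧸ S) ⧸ LinearMap.range F) :=
    Submodule.liftQ (T.restrictScalars A) g (by
      intro x hx
      obtain ⟨y, rfl⟩ := (hTm x).mp hx
      rw [LinearMap.mem_ker, hg0]
      exact ⟨S.mkQ y, (hFm y).symm⟩)
  let ρ := ρ' ∘ₗ (Submodule.Quotient.restrictScalarsEquiv A T).symm.toLinearMap
  have hρ : ∀ x, ρ (T.mkQ x) = g x := fun x => rfl
  refine ⟨ρ, ?_, ?_⟩
  · intro y
    obtain ⟨x, rfl⟩ := hgs y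
    exact ⟨T.mkQ x, hρ x⟩
  · intro z
    obtain ⟨x, rfl⟩ := Submodule.mkQ_surjective T z
    rw [hρ, hg0]
    constructor
    · rintro ⟨y, hy⟩
      obtain ⟨y, rfl⟩ := Submodule.mkQ_surjective S y
      rw [hFm, ← sub_eq_zero, ← map_sub, Submodule.mkQ_apply, Submodule.Quotient.mk_eq_zero,
        hS] at hy
      obtain ⟨w, hw⟩ := hy
      refine ⟨T.mkQ w, ?_⟩
      have h1 : T.mkQ ((X - C a) • y) = 0 :=
        (Submodule.Quotient.mk_eq_zero _).mpr ((hTm _).mpr ⟨y, rfl⟩)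
      have h2 := congrArg T.mkQ hw
      rw [map_sub, h1, sub_zero] at h2
      exact h2
    · rintro ⟨w, hw⟩
      obtain ⟨w, rfl⟩ := Submodule.mkQ_surjective T w
      have h1 : T.mkQ (x - c • w) = 0 := by
        rw [map_sub, hw]
        exact sub_self _
      rw [Submodule.mkQ_apply, Submodule.Quotient.mk_eq_zero, hTm] at h1
      obtain ⟨y, hy⟩ := h1
      refine ⟨S.mkQ y, ?_⟩
      rw [hFm, ← hy, map_sub, (show S.mkQ (c • w) = 0 from
        (Submodule.Quotient.mk_eq_zero _).mpr ((hS _).mpr ⟨w, rfl⟩)), sub_zero]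

lemma fl_filt {A N : Type*} [CommRing A] [IsDomain A] [IsNoetherianRing A] [Ring.KrullDimLE 1 A]
    [AddCommGroup N] [Module A N] [Module A[X] N] [IsScalarTower A A[X] N] [Module.Finite A[X] N]
    (c : A) (hc : c ≠ 0) (hcN : ∀ x : N, c • x = 0) :
    ∃ G : ℕ → Submodule A N,
      (∀ d, G (d + 1) = G d ⊔ (G d).map (Algebra.lsmul A A N (X : A[X]))) ∧
      (∀ d, IsFiniteLength A (G d)) ∧ ∀ x, ∃ d, x ∈ G d := by
  classical
  set V := Algebra.lsmul A A N (X : A[X]) with hV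
  obtain ⟨s, hs⟩ := (Module.finite_def (R := A[X]) (M := N)).mp inferInstance
  obtain ⟨G, hG0, hG⟩ : ∃ G : ℕ → Submodule A N, G 0 = Submodule.span A (s : Set N) ∧
      ∀ d, G (d + 1) = G d ⊔ (G d).map V :=
    ⟨fun d => Nat.rec (motive := fun _ => Submodule A N) (Submodule.span A (s : Set N))
      (fun _ G => G ⊔ G.map V) d, rfl, fun _ => rfl⟩
  have hmono : Monotone G := monotone_nat_of_le_succ fun d => by rw [hG]; exact le_sup_left
  have hfin : ∀ d : ℕ, IsFiniteLength A ↥(G d) := by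
    intro d
    induction d with
    | zero => rw [hG0]; exact fl_finlen c hc hcN s
    | succ d ih =>
      rw [isFiniteLength_iff_isNoetherian_isArtinian] at ih ⊢
      obtain ⟨h1, h2⟩ := ih
      rw [hG]
      have e : (G d).map V = LinearMap.range (V ∘ₗ (G d).subtype) := by
        rw [LinearMap.range_comp, Submodule.range_subtype]
      rw [e]
      exact ⟨inferInstance, inferInstance⟩
  have hex : ∀ x, ∃ d, x ∈ G d := by
    intro x
    have hx : x ∈ Submodule.span A[X] (s : Set (N)) := hs ▸ Submodule.mem_top
    induction hx using Submodule.span_induction with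
    | mem x hx => exact ⟨0, hG0 ▸ Submodule.subset_span hx⟩
    | zero => exact ⟨0, Submodule.zero_mem _⟩
    | add x y _ _ hx hy =>
      obtain ⟨d, hd⟩ := hx
      obtain ⟨e, he⟩ := hy
      exact ⟨max d e, add_mem (hmono (le_max_left _ _) hd) (hmono (le_max_right _ _) he)⟩
    | smul f x _ hx =>
      obtain ⟨d, hd⟩ := hx
      induction f using Polynomial.induction_on' with
      | add f g hf hg =>
        obtain ⟨d, hd⟩ := hf
        obtain ⟨e, he⟩ := hg
        rw [add_smul]
        exact ⟨max d e, add_mem (hmono (le_max_left _ _) hd) (hmono (le_max_right _ _) he)⟩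
      | monomial n a =>
        rw [← C_mul_X_pow_eq_monomial, mul_smul, ← Polynomial.algebraMap_eq, algebraMap_smul]
        suffices h : ∃ d, (X : A[X]) ^ n • x ∈ G d by
          obtain ⟨e, he⟩ := h
          exact ⟨e, Submodule.smul_mem _ _ he⟩
        induction n with
        | zero => exact ⟨d, by simpa using hd⟩
        | succ n ih =>
          obtain ⟨e, he⟩ := ih
          refine ⟨e + 1, ?_⟩
          rw [hG, pow_succ', mul_smul]
          exact Submodule.mem_sup_right ⟨_, he, rfl⟩
  exact ⟨G, hG, hfin, hex⟩

lemma fl_mod {A M : Type*} [CommRing A] [IsDomain A] [IsNoetherianRing A] [Ring.KrullDimLE 1 A]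
    [AddCommGroup M] [Module A M] [Module A[X] M] [IsScalarTower A A[X] M] [Module.Finite A[X] M]
    (ℱ : ℤ → Submodule A M) (hint : DirectSum.IsInternal ℱ)
    (hdeg : ∀ i : ℤ, ∀ x ∈ ℱ i, (X : A[X]) • x ∈ ℱ (i - 1))
    (σ : A →+* A) (hσ : Function.Surjective σ) (p c : A) (hc : c ≠ 0) (hpσ : σ c = c)
    (φ : (M ⧸ (Ideal.span {X - C p} • (⊤ : Submodule A[X] M))) →ₛₗ[σ]
        (M ⧸ (Ideal.span {X - C (1 : A)} • (⊤ : Submodule A[X] M))))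
    (hφ : Function.Bijective φ) (x : M) (hx : ∃ y, (X - C p : A[X]) • x = c • y) :
    ∃ y, x = c • y := by
  classical
  have : RingHomSurjective σ := ⟨hσ⟩
  let S : Submodule A[X] M := LinearMap.range (LinearMap.lsmul A[X] M (C c))
  have hS : ∀ x, x ∈ S ↔ ∃ y, x = c • y := by
    intro x
    simp only [S, LinearMap.mem_range, LinearMap.lsmul_apply, ← Polynomial.algebraMap_eq,
      algebraMap_smul, eq_comm]
  obtain ⟨ρp, hρps, hρp⟩ := fl_rho p c S hS
  obtain ⟨ρ1, hρ1s, hρ1⟩ := fl_rho 1 c S hS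
  have hlen := fl_semilin σ (ρ1.comp φ) ρp hρps (by
    intro z hz
    obtain ⟨y, hy⟩ := (hρ1 _).mp hz
    obtain ⟨w, rfl⟩ := hφ.2 y
    rw [hρp]
    refine ⟨w, hφ.1 ?_⟩
    rw [hy, map_smulₛₗ, hpσ])
  have hF : ∀ (a : A) (y : M), (Algebra.lsmul A A (M ⧸ S) (X : A[X]) -
        algebraMap A (Module.End A (M ⧸ S)) a) (S.mkQ y) = S.mkQ ((X - C a) • y) := by
    intro a y
    simp only [LinearMap.sub_apply, Module.algebraMap_end_apply, Algebra.lsmul_coe,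
      sub_smul]
    rw [← Polynomial.algebraMap_eq, algebraMap_smul]
    rfl
  set V := Algebra.lsmul A A (M ⧸ S) (X : A[X]) with hV
  have hVx : ∀ x, V x = (X : A[X]) • x := fun x => rfl
  have hcN : ∀ x : M ⧸ S, c • x = 0 := by
    intro x
    obtain ⟨x, rfl⟩ := Submodule.mkQ_surjective S x
    exact (Submodule.Quotient.mk_eq_zero _).mpr ((hS _).mpr ⟨x, rfl⟩)
  obtain ⟨G, hG, hfin, hex⟩ := fl_filt c hc hcN
  have hb : Function.Injective (V - algebraMap A (Module.End A (M ⧸ S)) 1) := by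
    rw [← LinearMap.ker_eq_bot, eq_bot_iff]
    intro x hx
    obtain ⟨x, rfl⟩ := Submodule.mkQ_surjective S x
    rw [LinearMap.mem_ker, hF, Submodule.mkQ_apply, Submodule.Quotient.mk_eq_zero, hS] at hx
    have := fl_graded ℱ hint hdeg c (X - C 1) (by simp) x hx
    exact (Submodule.Quotient.mk_eq_zero _).mpr ((hS _).mpr this)
  have key := fl_key V G hG hex hfin p 1 hb hlen
  rw [← hS, ← Submodule.Quotient.mk_eq_zero]
  apply key
  rw [map_zero]
  refine (hF p x).trans ?_
  rw [Submodule.mkQ_apply, Submodule.Quotient.mk_eq_zero, hS]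
  exact hx

lemma fl_main {A M : Type*} [CommRing A] [IsDomain A] [IsDiscreteValuationRing A]
    [AddCommGroup M] [Module A M] [Module A[X] M] [IsScalarTower A A[X] M] [Module.Finite A[X] M]
    (ℱ : ℤ → Submodule A M) (hint : DirectSum.IsInternal ℱ)
    (hdeg : ∀ i : ℤ, ∀ x ∈ ℱ i, (X : A[X]) • x ∈ ℱ (i - 1))
    (σ : A →+* A) (hσ : Function.Surjective σ) (p : A) (hirr : Irreducible p) (hpσ : σ p = p)
    (φ : (M ⧸ (Ideal.span {X - C p} • (⊤ : Submodule A[X] M))) →ₛₗ[σ]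
        (M ⧸ (Ideal.span {X - C (1 : A)} • (⊤ : Submodule A[X] M))))
    (hφ : Function.Bijective φ) (a : A) (x : M) (hx : (X - C a : A[X]) • x = 0) : x = 0 := by
  have hp0 : p ≠ 0 := hirr.ne_zero
  have hnu : ¬ IsUnit p := hirr.not_isUnit
  have hmod := fun (n : ℕ) => fl_mod ℱ hint hdeg _ hσ p
    (p ^ n) (pow_ne_zero n hp0) (by rw [map_pow, hpσ]) φ hφ
  have hsep : ∀ x : M, (∀ n : ℕ, ∃ y : M, x = p ^ n • y) → x = 0 := by
    intro x hx
    have h1 : x ∈ (⨅ i : ℕ, (Ideal.span {Polynomial.C p}) ^ i • ⊤ :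
        Submodule (Polynomial A) M) := by
      rw [Submodule.mem_iInf]
      intro n
      rw [Ideal.span_singleton_pow, Submodule.ideal_span_singleton_smul,
        Submodule.mem_smul_pointwise_iff_exists]
      obtain ⟨y, hy⟩ := hx n
      refine ⟨y, Submodule.mem_top, ?_⟩
      rw [hy, ← Polynomial.C_pow, ← Polynomial.algebraMap_eq, algebraMap_smul]
    rw [Ideal.mem_iInf_smul_pow_eq_bot_iff] at h1
    obtain ⟨⟨r, hr⟩, hrx⟩ := h1
    obtain ⟨q, rfl⟩ := Ideal.mem_span_singleton.mp hr
    obtain ⟨y, hy⟩ := fl_graded ℱ hint hdeg 0 (1 - Polynomial.C p * q) (by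
      have h2 : p * q.coeff 0 ∈ nonunits _ := by
        rw [mem_nonunits_iff]
        exact fun h => hnu (isUnit_of_mul_isUnit_left h)
      simpa using IsLocalRing.isUnit_one_sub_self_of_mem_nonunits _ h2) x ⟨0, by
        rw [sub_smul, one_smul]
        simpa [sub_eq_zero] using hrx.symm⟩
    rw [hy, zero_smul]
  have main : ∀ (a : A) (x : M),
      (Polynomial.X - Polynomial.C a : Polynomial A) • x = 0 → x = 0 := by
    intro a x hx
    by_cases ha : IsUnit a
    · obtain ⟨y, hy⟩ := fl_graded ℱ hint hdeg 0 (Polynomial.X - Polynomial.C a)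
        (by simpa using ha) x ⟨0, by rw [hx, smul_zero]⟩
      rw [hy, zero_smul]
    · obtain ⟨b, rfl⟩ : p ∣ a := by
        have h1 : a ∈ IsLocalRing.maximalIdeal A := ha
        rw [hirr.maximalIdeal_eq] at h1
        exact Ideal.mem_span_singleton.mp h1
      apply hsep
      intro n
      -- descending: `p ^ (n - j) x` lies in `p ^ n M`
      have hdesc : ∀ j : ℕ, j ≤ n → ∃ y : M, p ^ (n - j) • x =
          p ^ n • y := by
        intro j
        induction j with
        | zero => exact fun _ => ⟨x, rfl⟩
        | succ j ih =>
          intro hj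
          obtain ⟨y, hy⟩ := ih (by omega)
          apply hmod n
          have hXx : (Polynomial.X : Polynomial A) • x =
              (p * b) • x := by
            rw [sub_smul, sub_eq_zero] at hx
            rw [hx, ← Polynomial.algebraMap_eq, algebraMap_smul]
          refine ⟨(b - 1) • y, ?_⟩
          rw [sub_smul, ← Polynomial.algebraMap_eq, algebraMap_smul,
            smul_comm (Polynomial.X : Polynomial A), hXx, smul_smul, smul_smul,
            ← sub_smul, smul_comm _ (b - 1) y, ← hy, smul_smul]
          congr 1
          have e : n - j = n - (j + 1) + 1 := by omega
          rw [e]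
          ring
      simpa using hdesc n le_rfl
  exact main a x hx

end

/-- Let `(M, φ)` be a Fontaine–Laffaille module over `W(k)`: `M` is a
finitely generated ℤ-graded `W[v]`-module and `φ : M/(v−p)M → M/(v−1)M` a σ-semilinear
bijection, σ being the Witt-vector Frobenius. Then for every `a ∈ W`, multiplication by
`v − a` on `M` is injective; in particular multiplication by `v` is injective. -/
theorem stmt_13 (p : ℕ) [Fact p.Prime] (k : Type*) [Field k] [CharP k p] [PerfectRing k p]
    (M : Type*) [AddCommGroup M] [Module (WittVector p k) M]
    [Module (Polynomial (WittVector p k)) M]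
    [IsScalarTower (WittVector p k) (Polynomial (WittVector p k)) M]
    [Module.Finite (Polynomial (WittVector p k)) M]
    (ℱ : ℤ → Submodule (WittVector p k) M) (hint : DirectSum.IsInternal ℱ)
    (hdeg : ∀ i : ℤ, ∀ x ∈ ℱ i,
      (Polynomial.X : Polynomial (WittVector p k)) • x ∈ ℱ (i - 1))
    (φ : (M ⧸ (Ideal.span {Polynomial.X - Polynomial.C ((p : WittVector p k))} •
            (⊤ : Submodule (Polynomial (WittVector p k)) M))) →ₛₗ[
          (WittVector.frobenius : WittVector p k →+* WittVector p k)]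
        (M ⧸ (Ideal.span {Polynomial.X - Polynomial.C ((1 : WittVector p k))} •
            (⊤ : Submodule (Polynomial (WittVector p k)) M))))
    (hφ : Function.Bijective φ) :
    (∀ a : WittVector p k,
      Function.Injective fun x : M =>
        ((Polynomial.X - Polynomial.C a : Polynomial (WittVector p k))) • x) ∧
    Function.Injective fun x : M =>
      ((Polynomial.X : Polynomial (WittVector p k))) • x := by
  have hσ : Function.Surjective (WittVector.frobenius : WittVector p k →+* WittVector p k) :=
    (WittVector.frobenius_bijective p k).2
  have main := fl_main ℱ hint hdeg _ hσ (p : WittVector p k) (WittVector.irreducible p)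
    (map_natCast _ p) φ hφ
  have inj : ∀ f : Polynomial (WittVector p k), (∀ x : M, f • x = 0 → x = 0) →
      Function.Injective fun x : M => f • x := by
    intro f hf x y hxy
    rw [← sub_eq_zero]
    apply hf
    rw [smul_sub, sub_eq_zero]
    exact hxy
  refine ⟨fun a => inj _ (main a), inj _ fun x hx => main 0 x ?_⟩
  simpa using hx
end

section
/- Let M be a finitely generated ℤ-graded k[v]-module equipped with a σ_k-semilinear bijection φ: M/vM → M/(v−1)M (a Fontaine–Laffaille module killed by p). Then there exist: a finitely generated ℤ-graded W[v]-module M̃ on which multiplication by p is injective; a σ-semilinear bijection φ̃: M̃/(v−p)M̃ → M̃/(v−1)M̃; and an isomorphism of graded modules M̃/pM̃ ≅ M (compatible with the ring map W[v] → k[v]) under which the mod-p reduction of φ̃ is identified with φ. That is, every p-torsion Fontaine–Laffaille module lifts to a p-torsion-free Fontaine–Laffaille module over W(k). -/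
universe u v

/-- A finitely generated ℤ-graded `R[v]`-module (with `v` of degree `−1`), bundled. -/
structure GradedModuleData (R : Type u) [CommRing R] where
  /-- the underlying module -/
  carrier : Type v
  [acg : AddCommGroup carrier]
  [modR : Module R carrier]
  [modP : Module (Polynomial R) carrier]
  [tower : IsScalarTower R (Polynomial R) carrier]
  /-- the grading -/
  grading : ℤ → Submodule R carrier
  internal : DirectSum.IsInternal grading
  deg_X : ∀ i : ℤ, ∀ x ∈ grading i,
    (Polynomial.X : Polynomial R) • x ∈ grading (i - 1)
  fin : Module.Finite (Polynomial R) carrier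

attribute [instance] GradedModuleData.acg GradedModuleData.modR GradedModuleData.modP
  GradedModuleData.tower GradedModuleData.fin

/-- The submodule `(v−a)·M` of a `R[v]`-module `M`. -/
noncomputable def fiberSub {R : Type*} [CommRing R] (M : Type*) [AddCommGroup M]
    [Module (Polynomial R) M] (a : R) : Submodule (Polynomial R) M :=
  Ideal.span {Polynomial.X - Polynomial.C a} • ⊤

section helpers

open Polynomial

set_option linter.unusedSectionVars false

variable {R : Type*} [CommRing R] {M : Type*} [AddCommGroup M] [Module R M] [Module R[X] M]
  [IsScalarTower R R[X] M]

theorem mem_fiberSub_iff (a : R) (x : M) :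
    x ∈ fiberSub M a ↔ ∃ y : M, (X - C a) • y = x := by
  unfold fiberSub
  rw [Submodule.ideal_span_singleton_smul, Submodule.mem_smul_pointwise_iff_exists]
  simp

theorem C_smul_eq (c : R) (x : M) : (C c : R[X]) • x = c • x := by
  rw [← Polynomial.algebraMap_eq, algebraMap_smul]

theorem smul_mk_fiberSub (a : R) (f : R[X]) (x : M) :
    (Submodule.Quotient.mk (f • x) : M ⧸ fiberSub M a)
      = f.eval a • (Submodule.Quotient.mk x : M ⧸ fiberSub M a) := by
  rw [← Submodule.Quotient.mk_smul, Submodule.Quotient.eq, mem_fiberSub_iff]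
  obtain ⟨g, hg⟩ := Polynomial.X_sub_C_dvd_sub_C_eval (p := f) (a := a)
  refine ⟨g • x, ?_⟩
  rw [smul_smul, ← hg, sub_smul, C_smul_eq]

theorem mk_mem_span_fiberSub (a : R) {ι : Type*} (b : ι → M) (x : M)
    (hx : x ∈ Submodule.span R[X] (Set.range b)) :
    (Submodule.Quotient.mk x : M ⧸ fiberSub M a) ∈
      Submodule.span R (Set.range fun j => (Submodule.Quotient.mk (b j) : M ⧸ fiberSub M a)) := by
  induction hx using Submodule.span_induction with
  | mem x h =>
    obtain ⟨j, rfl⟩ := h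
    exact Submodule.subset_span ⟨j, rfl⟩
  | zero => simp
  | add x y _ _ h1 h2 =>
    rw [Submodule.Quotient.mk_add]
    exact add_mem h1 h2
  | smul f x _ h =>
    rw [smul_mk_fiberSub]
    exact Submodule.smul_mem _ _ h

theorem finite_fiberSub [Module.Finite R[X] M] (a : R) : Module.Finite R (M ⧸ fiberSub M a) := by
  obtain ⟨n, s, hs⟩ := Module.Finite.exists_fin (R := R[X]) (M := M)
  refine ⟨?_⟩
  have : (⊤ : Submodule R (M ⧸ fiberSub M a)) =
      Submodule.span R (Set.range fun j => (Submodule.Quotient.mk (s j) : M ⧸ fiberSub M a)) := by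
    symm
    rw [eq_top_iff]
    rintro x -
    obtain ⟨x, rfl⟩ := Submodule.Quotient.mk_surjective _ x
    exact mk_mem_span_fiberSub a s x (by rw [hs]; trivial)
  rw [this]
  exact Submodule.fg_span (Set.finite_range _)

/-- Evaluation at `a` in coordinates. -/
noncomputable def evMap {n : ℕ} (B : Module.Basis (Fin n) R[X] M) (a : R) : M →ₗ[R] (Fin n → R) where
  toFun x j := (B.repr x j).eval a
  map_add' x y := by ext j; simp
  map_smul' c x := by ext j; simp [← C_smul_eq]

theorem evMap_eq_zero_iff {n : ℕ} (B : Module.Basis (Fin n) R[X] M) (a : R) (x : M) :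
    evMap B a x = 0 ↔ x ∈ fiberSub M a := by
  rw [mem_fiberSub_iff]
  constructor
  · intro h
    have h1 : ∀ j, ∃ g, B.repr x j = (X - C a) * g := fun j =>
      Polynomial.dvd_iff_isRoot.2 (congrFun h j)
    choose g hg using h1
    refine ⟨∑ j, g j • B j, ?_⟩
    conv_rhs => rw [← B.sum_repr x]
    rw [Finset.smul_sum]
    exact Finset.sum_congr rfl fun j _ => by rw [smul_smul, hg]
  · rintro ⟨y, rfl⟩
    ext j
    simp [evMap]

theorem evMap_surjective {n : ℕ} (B : Module.Basis (Fin n) R[X] M) (a : R) :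
    Function.Surjective (evMap B a) := by
  intro w
  refine ⟨∑ j, (C (w j) : R[X]) • B j, ?_⟩
  ext j
  show (B.repr _ j).eval a = _
  rw [B.repr_sum_self]
  simp

/-- The evaluation map on the fibre at `a`. -/
noncomputable def evQuot {n : ℕ} (B : Module.Basis (Fin n) R[X] M) (a : R) :
    (M ⧸ fiberSub M a) →ₗ[R] (Fin n → R) where
  toFun := QuotientAddGroup.lift (fiberSub M a).toAddSubgroup
        (evMap B a).toAddMonoidHom (fun x hx => (evMap_eq_zero_iff B a x).2 hx)
  map_add' := fun x y => map_add (QuotientAddGroup.lift (fiberSub M a).toAddSubgroup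
        (evMap B a).toAddMonoidHom (fun x hx => (evMap_eq_zero_iff B a x).2 hx)) x y
  map_smul' := by
    rintro c ⟨x⟩
    exact (evMap B a).map_smul c x

/-- The fibre at `a` of a free module in coordinates. -/
noncomputable def evEquiv {n : ℕ} (B : Module.Basis (Fin n) R[X] M) (a : R) :
    (M ⧸ fiberSub M a) ≃ₗ[R] (Fin n → R) :=
  LinearEquiv.ofBijective (evQuot B a) (by
    constructor
    · rw [← LinearMap.ker_eq_bot, LinearMap.ker_eq_bot']
      rintro ⟨x⟩ hx
      exact (Submodule.Quotient.mk_eq_zero _).2 ((evMap_eq_zero_iff B a x).1 hx)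
    · intro w
      obtain ⟨x, hx⟩ := evMap_surjective B a w
      exact ⟨Submodule.Quotient.mk x, hx⟩)

theorem evEquiv_mk {n : ℕ} (B : Module.Basis (Fin n) R[X] M) (a : R) (x : M) (j : Fin n) :
    evEquiv B a (Submodule.Quotient.mk x) j = (B.repr x j).eval a := rfl

/-- The grading of a free module with basis in degrees `d`. -/
def freeGrading {n : ℕ} (B : Module.Basis (Fin n) R[X] M) (d : Fin n → ℤ) (i : ℤ) :
    Submodule R M where
  carrier := {x | ∀ (j : Fin n) (m : ℕ), d j - (m : ℤ) ≠ i → (B.repr x j).coeff m = 0}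
  add_mem' := by
    intro x y hx hy j m h
    simp [hx j m h, hy j m h]
  zero_mem' := by intro j m h; simp
  smul_mem' := by
    intro c x hx j m h
    simp [← C_smul_eq, hx j m h]

theorem freeGrading_X {n : ℕ} (B : Module.Basis (Fin n) R[X] M) (d : Fin n → ℤ) (i : ℤ) (x : M)
    (hx : x ∈ freeGrading B d i) : (X : R[X]) • x ∈ freeGrading B d (i - 1) := by
  intro j m h
  cases m with
  | zero => simp
  | succ m =>
    have := hx j m (by push_cast at h; omega)
    simpa using this

theorem freeGrading_internal {n : ℕ} (B : Module.Basis (Fin n) R[X] M) (d : Fin n → ℤ) :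
    DirectSum.IsInternal (freeGrading B d) := by
  classical
  constructor
  · rw [injective_iff_map_eq_zero]
    intro x hx
    have key : ∀ (y : DirectSum ℤ fun i => freeGrading B d i) (j : Fin n) (m : ℕ),
        (B.repr (DirectSum.coeAddMonoidHom (freeGrading B d) y) j).coeff m
          = (B.repr (y (d j - m) : M) j).coeff m := by
      intro y j m
      induction y using DirectSum.induction_on with
      | zero => simp
      | of i z =>
        rw [DirectSum.coeAddMonoidHom_of]
        by_cases h : d j - m = i
        · subst h; rw [DirectSum.of_eq_same]
        · rw [DirectSum.of_eq_of_ne _ _ _ h]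
          simpa using z.2 j m h
      | add y z h1 h2 =>
        simp [h1, h2]
    refine DFinsupp.ext fun i => Subtype.ext ?_
    apply B.repr.injective
    ext j m
    by_cases h : d j - m = i
    · subst h
      rw [← key, hx]; simp
    · simpa using (x i).2 j m h
  · intro x
    show x ∈ (DirectSum.coeAddMonoidHom (freeGrading B d)).range
    rw [← B.sum_repr x]
    refine sum_mem fun j _ => ?_
    rw [(B.repr x j).as_sum_support, Finset.sum_smul]
    refine sum_mem fun m _ => ?_
    refine ⟨DirectSum.of (fun i => freeGrading B d i) (d j - m) ⟨_, ?_⟩,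
      DirectSum.coeAddMonoidHom_of _ _ _⟩
    intro j' m' h
    simp only [map_smul, Module.Basis.repr_self, Finsupp.smul_single, smul_eq_mul, mul_one]
    by_cases hj : j = j'
    · subst hj
      rw [Finsupp.single_eq_same, Polynomial.coeff_monomial, if_neg]
      rintro rfl
      exact h rfl
    · rw [Finsupp.single_eq_of_ne' hj]; simp

end helpers

section graded

open Polynomial

set_option linter.unusedSectionVars false

/-- The projection to the degree `i` component. -/
noncomputable def gproj {k M : Type*} [Field k] [AddCommGroup M] [Module k M]
    (ℱ : ℤ → Submodule k M) [DirectSum.Decomposition ℱ] (i : ℤ) : M →ₗ[k] M :=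
  (ℱ i).subtype ∘ₗ DirectSum.component k ℤ (fun i => ℱ i) i ∘ₗ
    (DirectSum.decomposeLinearEquiv ℱ).toLinearMap

variable {k M : Type*} [Field k] [AddCommGroup M] [Module k M] [Module k[X] M]
    [IsScalarTower k k[X] M]

theorem gproj_same (ℱ : ℤ → Submodule k M) [DirectSum.Decomposition ℱ] (i : ℤ) (x : M)
    (hx : x ∈ ℱ i) : gproj ℱ i x = x := DirectSum.decompose_of_mem_same ℱ hx

theorem gproj_ne (ℱ : ℤ → Submodule k M) [DirectSum.Decomposition ℱ] (i d : ℤ) (x : M)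
    (hx : x ∈ ℱ d) (h : d ≠ i) : gproj ℱ i x = 0 := DirectSum.decompose_of_mem_ne ℱ hx h

theorem pow_smul_mem (ℱ : ℤ → Submodule k M)
    (hdeg : ∀ i : ℤ, ∀ x ∈ ℱ i, (X : k[X]) • x ∈ ℱ (i - 1)) (d : ℤ) (x : M) (hx : x ∈ ℱ d)
    (m : ℕ) : (X ^ m : k[X]) • x ∈ ℱ (d - m) := by
  induction m with
  | zero => simpa using hx
  | succ m ih =>
    rw [pow_succ', mul_smul]
    have := hdeg _ _ ih
    push_cast
    rwa [← sub_sub]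

theorem gproj_smul (ℱ : ℤ → Submodule k M) [DirectSum.Decomposition ℱ]
    (hdeg : ∀ i : ℤ, ∀ x ∈ ℱ i, (X : k[X]) • x ∈ ℱ (i - 1)) (d i : ℤ) (x : M) (hx : x ∈ ℱ d)
    (f : k[X]) : gproj ℱ i (f • x) =
      (if i ≤ d then monomial (d - i).toNat (f.coeff (d - i).toNat) else 0) • x := by
  induction f using Polynomial.induction_on' with
  | add f g hf hg =>
    rw [add_smul, map_add, hf, hg, ← add_smul]
    split_ifs <;> simp
  | monomial m c =>
    have hm : (monomial m c : k[X]) • x ∈ ℱ (d - m) := by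
      rw [← C_mul_X_pow_eq_monomial, mul_smul, C_smul_eq]
      exact Submodule.smul_mem _ _ (pow_smul_mem ℱ hdeg d x hx m)
    by_cases h : d - m = i
    · rw [gproj_same ℱ i _ (h ▸ hm), if_pos (by omega)]
      have : (d - i).toNat = m := by omega
      rw [this, coeff_monomial, if_pos rfl]
    · rw [gproj_ne ℱ i _ _ hm h]
      split_ifs with h2
      · rw [coeff_monomial, if_neg (by omega)]; simp
      · simp

theorem exists_graded_basis (p : ℕ) [Fact p.Prime] [CharP k p] [PerfectRing k p]
    [Module.Finite k[X] M]
    (ℱ : ℤ → Submodule k M) (hint : DirectSum.IsInternal ℱ)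
    (hdeg : ∀ i : ℤ, ∀ x ∈ ℱ i, (X : k[X]) • x ∈ ℱ (i - 1))
    (σk : k →+* k) (hσk : ∀ c : k, σk c = c ^ p)
    (φ : (M ⧸ fiberSub M (0 : k)) →ₛₗ[σk] (M ⧸ fiberSub M (1 : k)))
    (hφ : Function.Bijective φ) :
    ∃ (n : ℕ) (b : Module.Basis (Fin n) k[X] M) (d : Fin n → ℤ), ∀ j, b j ∈ ℱ (d j) := by
  classical
  let _ := hint.chooseDecomposition
  have := finite_fiberSub (M := M) (0 : k)
  have := finite_fiberSub (M := M) (1 : k)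
  -- homogeneous elements
  let h : (Σ i, ℱ i) → M ⧸ fiberSub M (0 : k) := fun s => Submodule.Quotient.mk (s.2 : M)
  have hspan : Submodule.span k (Set.range h) = ⊤ := by
    rw [eq_top_iff]
    rintro x -
    obtain ⟨x, rfl⟩ := Submodule.Quotient.mk_surjective _ x
    rw [← DirectSum.sum_support_decompose ℱ x]
    rw [← Submodule.mkQ_apply, map_sum]
    exact sum_mem fun i _ => Submodule.subset_span ⟨⟨i, _⟩, rfl⟩
  obtain ⟨κ, a, -, hspan', hli⟩ := exists_linearIndependent' k h
  rw [hspan] at hspan'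
  have hfin : Finite κ := hli.finite
  obtain ⟨n, ⟨e⟩⟩ := Finite.exists_equiv_fin κ
  let d : Fin n → ℤ := fun j => (a (e.symm j)).1
  let b : Fin n → M := fun j => ((a (e.symm j)).2 : M)
  have hb : ∀ j, b j ∈ ℱ (d j) := fun j => ((a (e.symm j)).2).2
  have hb0 : LinearIndependent k
      (fun j => (Submodule.Quotient.mk (b j) : M ⧸ fiberSub M (0 : k))) :=
    hli.comp e.symm e.symm.injective
  have hb0s : Submodule.span k (Set.range
      (fun j => (Submodule.Quotient.mk (b j) : M ⧸ fiberSub M (0 : k)))) = ⊤ := by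
    rw [← hspan']
    congr 1
    exact e.symm.surjective.range_comp (h ∘ a)
  -- Nakayama
  have hgen : Submodule.span k[X] (Set.range b) = ⊤ := by
    set N := Submodule.span k[X] (Set.range b) with hN
    have hcl : ∀ x ∈ N, ∀ i, gproj ℱ i x ∈ N := by
      intro x hx i
      obtain ⟨c, rfl⟩ := (Submodule.mem_span_range_iff_exists_fun k[X]).1 hx
      rw [map_sum]
      refine sum_mem fun j _ => ?_
      rw [gproj_smul ℱ hdeg (d j) i (b j) (hb j)]
      exact N.smul_mem _ (Submodule.subset_span ⟨j, rfl⟩)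
    have hle : (⊤ : Submodule k[X] (M ⧸ N)) ≤ Ideal.span {(X : k[X])} • ⊤ := by
      rintro x -
      obtain ⟨x, rfl⟩ := Submodule.Quotient.mk_surjective _ x
      have hx : (Submodule.Quotient.mk x : M ⧸ fiberSub M (0 : k)) ∈ Submodule.span k (Set.range
          (fun j => (Submodule.Quotient.mk (b j) : M ⧸ fiberSub M (0 : k)))) := by
        rw [hb0s]; trivial
      obtain ⟨c, hc⟩ := (Submodule.mem_span_range_iff_exists_fun k).1 hx
      have hc' : (Submodule.Quotient.mk x : M ⧸ fiberSub M (0 : k)) =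
          Submodule.Quotient.mk (∑ j, c j • b j) := by
        rw [← hc]
        simp only [← Submodule.mkQ_apply, map_sum]
        rfl
      rw [Submodule.Quotient.eq, mem_fiberSub_iff] at hc'
      obtain ⟨y, hy⟩ := hc'
      have : (Submodule.Quotient.mk x : M ⧸ N) = (X : k[X]) • Submodule.Quotient.mk y := by
        rw [← Submodule.Quotient.mk_smul, Submodule.Quotient.eq]
        have h1 : x - (X : k[X]) • y = ∑ j, c j • b j := by
          rw [C_0, sub_zero] at hy
          rw [hy]; abel
        rw [h1]
        refine sum_mem fun j _ => ?_
        rw [← C_smul_eq]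
        exact N.smul_mem _ (Submodule.subset_span ⟨j, rfl⟩)
      rw [this]
      exact Submodule.smul_mem_smul (Ideal.mem_span_singleton_self _) trivial
    obtain ⟨g, hg1, hg⟩ := Submodule.exists_sub_one_mem_and_smul_eq_zero_of_fg_of_le_smul
      _ _ (Module.Finite.fg_top) hle
    have hg0 : g.coeff 0 = 1 := by
      obtain ⟨q, hq⟩ := Ideal.mem_span_singleton.1 hg1
      have : g = 1 + X * q := by rw [← hq]; ring
      rw [this]; simp
    rw [eq_top_iff]
    rintro x -
    rw [← DirectSum.sum_support_decompose ℱ x]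
    refine sum_mem fun i _ => ?_
    set z := DirectSum.decompose ℱ x i
    have h1 : g • (z : M) ∈ N := by
      rw [← Submodule.Quotient.mk_eq_zero, Submodule.Quotient.mk_smul]
      exact hg _ trivial
    have h2 := hcl _ h1 i
    rw [gproj_smul ℱ hdeg i i _ z.2] at h2
    simpa [hg0] using h2
  -- dimension count
  have hbij : Function.Bijective σk := by
    have : (σk : k → k) = frobenius k p := by ext c; simp [hσk, frobenius_def]
    rw [this]
    exact bijective_frobenius k p
  have hrank : Module.finrank k (M ⧸ fiberSub M (0 : k)) =
      Module.finrank k (M ⧸ fiberSub M (1 : k)) := by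
    have := lift_rank_eq_of_equiv_equiv (σk : k → k) (AddEquiv.ofBijective φ hφ) hbij
      (fun r m => φ.map_smulₛₗ r m)
    rw [Cardinal.lift_id, Cardinal.lift_id] at this
    simp only [Module.finrank, this]
  have hn : Module.finrank k (M ⧸ fiberSub M (0 : k)) = n := by
    rw [Module.finrank_eq_card_basis (Module.Basis.mk hb0 hb0s.ge)]; simp
  have hb1 : LinearIndependent k
      (fun j => (Submodule.Quotient.mk (b j) : M ⧸ fiberSub M (1 : k))) := by
    apply linearIndependent_of_top_le_span_of_card_eq_finrank
    · rintro x -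
      obtain ⟨x, rfl⟩ := Submodule.Quotient.mk_surjective _ x
      exact mk_mem_span_fiberSub 1 b x (by rw [hgen]; trivial)
    · rw [← hrank, hn]; simp
  have hbli : LinearIndependent k[X] b := by
    rw [Fintype.linearIndependent_iff]
    intro f hf j
    ext m
    have h1 := congrArg (gproj ℱ (d j - m)) hf
    rw [map_sum, map_zero] at h1
    simp only [fun j' => gproj_smul ℱ hdeg (d j') (d j - m) (b j') (hb j')] at h1
    have h2 := congrArg (Submodule.Quotient.mk (p := fiberSub M (1 : k))) h1
    rw [← Submodule.mkQ_apply, map_sum] at h2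
    simp only [Submodule.mkQ_apply, smul_mk_fiberSub] at h2
    have h3 := Fintype.linearIndependent_iff.1 hb1 _ h2 j
    rw [if_pos (by omega)] at h3
    simpa using h3
  exact ⟨n, Module.Basis.mk hbli hgen.ge, d, fun j => by simpa using hb j⟩

end graded

section lifting

open Polynomial

set_option linter.unusedSectionVars false

theorem small_witt_poly (p : ℕ) (k : Type u) [Small.{v} k] [Fact p.Prime] [CommRing k] (n : ℕ) :
    Small.{v} (Fin n → (WittVector p k)[X]) := by
  have h1 : Small.{v} (WittVector p k) :=
    small_of_injective (f := fun x : WittVector p k => x.coeff)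
      (fun x y h => WittVector.ext fun n => congrFun h n)
  have h2 : Small.{v} ((WittVector p k)[X]) :=
    small_of_injective (f := fun x : (WittVector p k)[X] => x.coeff)
      (fun x y h => Polynomial.ext fun n => congrFun h n)
  infer_instance

theorem small_of_graded_basis (p : ℕ) [Fact p.Prime] (k : Type u) [Field k]
    (M : Type v) [AddCommGroup M] [Module k[X] M] (n : ℕ) (b : Module.Basis (Fin n) k[X] M) :
    Small.{v} (Fin n → (WittVector p k)[X]) := by
  cases n with
  | zero => infer_instance
  | succ n =>
    have : Small.{v} k := by
      refine small_of_injective (f := fun c : k => (C c : k[X]) • b 0) ?_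
      intro c c' h
      have := congrArg (fun x => b.repr x 0) h
      simpa using this
    exact small_witt_poly p k (n + 1)

theorem ghost_zero_apply (p : ℕ) [Fact p.Prime] (k : Type u) [CommRing k] (x : WittVector p k) :
    WittVector.ghostComponent 0 x = x.coeff 0 := by
  simp [WittVector.ghostComponent_apply, wittPolynomial_zero]

variable (p : ℕ) [Fact p.Prime] (k : Type u) [Field k] [CharP k p] [PerfectRing k p]

theorem ghost_zero_eq_zero_iff (x : WittVector p k) :
    WittVector.ghostComponent 0 x = 0 ↔ ∃ y, x = p * y := by
  rw [ghost_zero_apply, ← WittVector.mem_span_p_iff_coeff_zero_eq_zero,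
    Ideal.mem_span_singleton]
  rfl

theorem ghost_zero_surjective :
    Function.Surjective (WittVector.ghostComponent 0 : WittVector p k →+* k) := by
  intro c
  exact ⟨WittVector.teichmuller p c, by rw [ghost_zero_apply]; simp⟩

theorem ghost_zero_p : (WittVector.ghostComponent 0 : WittVector p k →+* k) (p : WittVector p k) = 0 :=
  (ghost_zero_eq_zero_iff p k _).2 ⟨1, by simp⟩

theorem ghost_zero_frobenius (x : WittVector p k) :
    (WittVector.ghostComponent 0 : WittVector p k →+* k) (WittVector.frobenius x) =
      (WittVector.ghostComponent 0 x) ^ p := by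
  rw [ghost_zero_apply, ghost_zero_apply, WittVector.coeff_frobenius_charP]

/-- Reduction modulo `p` in coordinates. -/
noncomputable def redMap {D M : Type*} [AddCommGroup D] [Module (WittVector p k)[X] D]
    [AddCommGroup M] [Module k[X] M] {n : ℕ}
    (B : Module.Basis (Fin n) (WittVector p k)[X] D) (b : Module.Basis (Fin n) k[X] M) :
    D →ₛₗ[Polynomial.mapRingHom (WittVector.ghostComponent 0 : WittVector p k →+* k)] M where
  toFun x := ∑ j, ((B.repr x j).map (WittVector.ghostComponent 0 : WittVector p k →+* k)) • b j
  map_add' x y := by simp [add_smul, Finset.sum_add_distrib]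
  map_smul' f x := by simp [mul_smul, Finset.smul_sum]

variable {p k} {D M : Type*} [AddCommGroup D] [Module (WittVector p k)[X] D]
    [AddCommGroup M] [Module k[X] M] {n : ℕ}
    (B : Module.Basis (Fin n) (WittVector p k)[X] D) (b : Module.Basis (Fin n) k[X] M)

theorem redMap_repr (x : D) (j : Fin n) : b.repr (redMap p k B b x) j =
    (B.repr x j).map (WittVector.ghostComponent 0 : WittVector p k →+* k) := by
  show b.repr (∑ i, ((B.repr x i).map (WittVector.ghostComponent 0 : WittVector p k →+* k)) • b i) j = _
  rw [b.repr_sum_self]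

theorem redMap_surjective : Function.Surjective (redMap p k B b) := by
  intro y
  choose g hg using fun j => Polynomial.map_surjective
    (WittVector.ghostComponent 0 : WittVector p k →+* k) (ghost_zero_surjective p k) (b.repr y j)
  refine ⟨∑ j, g j • B j, ?_⟩
  apply b.repr.injective
  ext1 j
  rw [redMap_repr, B.repr_sum_self, hg]

theorem redMap_eq_zero_iff (x : D) : redMap p k B b x = 0 ↔
    x ∈ (Ideal.span {((p : ℕ) : (WittVector p k)[X])} • (⊤ : Submodule (WittVector p k)[X] D)) := by
  rw [Submodule.ideal_span_singleton_smul, Submodule.mem_smul_pointwise_iff_exists]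
  constructor
  · intro h
    have h1 : ∀ j, ∃ g : (WittVector p k)[X], B.repr x j = (p : (WittVector p k)[X]) * g := by
      intro j
      have h2 := redMap_repr B b x j
      rw [h] at h2
      rw [← Polynomial.C_eq_natCast]
      apply (Polynomial.C_dvd_iff_dvd_coeff _ _).2
      intro m
      apply (ghost_zero_eq_zero_iff p k _).1
      rw [← Polynomial.coeff_map, ← h2]
      simp
    choose g hg using h1
    refine ⟨∑ j, g j • B j, trivial, ?_⟩
    conv_rhs => rw [← B.sum_repr x]
    rw [Finset.smul_sum]
    exact Finset.sum_congr rfl fun j _ => by rw [smul_smul, hg]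
  · rintro ⟨y, -, rfl⟩
    rw [LinearMap.map_smulₛₗ]
    have : (Polynomial.mapRingHom (WittVector.ghostComponent 0 : WittVector p k →+* k))
        ((p : ℕ) : (WittVector p k)[X]) = 0 := by
      rw [map_natCast, CharP.cast_eq_zero]
    rw [this, zero_smul]

/-- The isomorphism `D / p D ≃ M`. -/
noncomputable def redEquiv : (D ⧸ (Ideal.span {((p : ℕ) : (WittVector p k)[X])} •
    (⊤ : Submodule (WittVector p k)[X] D))) ≃+ M :=
  AddEquiv.ofBijective (Submodule.liftQ _ (redMap p k B b)
    (fun x hx => (redMap_eq_zero_iff B b x).2 hx)) (by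
    constructor
    · rw [injective_iff_map_eq_zero]
      intro x hx
      obtain ⟨x, rfl⟩ := Submodule.Quotient.mk_surjective _ x
      change redMap p k B b x = 0 at hx
      exact (Submodule.Quotient.mk_eq_zero _).2 ((redMap_eq_zero_iff B b x).1 hx)
    · intro y
      obtain ⟨x, hx⟩ := redMap_surjective B b y
      exact ⟨Submodule.Quotient.mk x, hx⟩)

theorem redEquiv_mk (x : D) : redEquiv B b (Submodule.Quotient.mk x) = redMap p k B b x := rfl

/-- The lift of Frobenius given by a matrix. -/
noncomputable def frobLift [Module (WittVector p k) D]
    [IsScalarTower (WittVector p k) (WittVector p k)[X] D]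
    (A : Matrix (Fin n) (Fin n) (WittVector p k)) :
    (D ⧸ fiberSub D (p : WittVector p k)) →ₛₗ[
      (WittVector.frobenius : WittVector p k →+* WittVector p k)]
      (D ⧸ fiberSub D (1 : WittVector p k)) where
  toFun q := (evEquiv B 1).symm
    (A.mulVec fun j => WittVector.frobenius (evEquiv B (p : WittVector p k) q j))
  map_add' x y := by
    rw [← map_add, ← Matrix.mulVec_add]
    congr 2
    ext1 j
    simp
  map_smul' c x := by
    rw [← map_smul, ← Matrix.mulVec_smul]
    congr 2
    ext1 j
    simp

theorem frobLift_bijective [Module (WittVector p k) D]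
    [IsScalarTower (WittVector p k) (WittVector p k)[X] D]
    (A : Matrix (Fin n) (Fin n) (WittVector p k)) (hA : IsUnit A) :
    Function.Bijective (frobLift B A) := by
  have h1 : Function.Bijective A.mulVec :=
    ⟨Matrix.mulVec_injective_of_isUnit hA, Matrix.mulVec_surjective_iff_isUnit.2 hA⟩
  have h2 : Function.Bijective (fun (w : Fin n → WittVector p k) (j : Fin n) =>
      WittVector.frobenius (w j)) := by
    have hF := WittVector.frobenius_bijective p k
    refine ⟨fun w w' h => funext fun j => hF.1 (congrFun h j), fun w => ?_⟩
    choose g hg using fun j => hF.2 (w j)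
    exact ⟨g, funext hg⟩
  exact (evEquiv B 1).symm.bijective.comp
    (h1.comp (h2.comp (evEquiv B (p : WittVector p k)).bijective))

theorem exists_small_model (R : Type u) [CommRing R] (n : ℕ) [Small.{v} (Fin n → R[X])] :
    ∃ (D : Type v) (_ : AddCommGroup D) (_ : Module R D) (_ : Module R[X] D)
      (_ : IsScalarTower R R[X] D), Nonempty (Module.Basis (Fin n) R[X] D) := by
  refine ⟨Shrink.{v} (Fin n → R[X]), inferInstance, inferInstance, inferInstance, ?_,
    ⟨(Pi.basisFun R[X] (Fin n)).map (Shrink.linearEquiv R[X] _).symm⟩⟩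
  refine ⟨fun c f x => ?_⟩
  apply (Shrink.linearEquiv R (Fin n → R[X])).injective
  have h1 : ∀ (g : R[X]) (y : Shrink.{v} (Fin n → R[X])),
      Shrink.linearEquiv R (Fin n → R[X]) (g • y) = g • Shrink.linearEquiv R (Fin n → R[X]) y :=
    fun g y => (Shrink.linearEquiv R[X] (Fin n → R[X])).map_smul g y
  rw [h1, map_smul, h1, smul_assoc]

theorem semilinear_eq_mulVec {K : Type*} [Field K] (σ : K →+* K) {P Q : Type*} [AddCommGroup P]
    [AddCommGroup Q] [Module K P] [Module K Q] {m : ℕ} (α : P ≃ₗ[K] (Fin m → K))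
    (β : Q ≃ₗ[K] (Fin m → K)) (φ : P →ₛₗ[σ] Q) (q : P) :
    β (φ q) = (Matrix.of fun i j => β (φ (α.symm (Pi.single j 1))) i).mulVec
      (fun j => σ (α q j)) := by
  have h : q = ∑ j, α q j • α.symm (Pi.single j 1) := by
    apply α.injective
    rw [map_sum]
    simp only [map_smul, LinearEquiv.apply_symm_apply]
    exact (pi_eq_sum_univ' (α q)).trans
      (Finset.sum_congr rfl fun j _ => by congr 1)
  conv_lhs => rw [h]
  ext i
  rw [map_sum, map_sum, Finset.sum_apply]
  simp only [Matrix.mulVec, dotProduct, Matrix.of_apply]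
  refine Finset.sum_congr rfl fun j _ => ?_
  rw [LinearMap.map_smulₛₗ, map_smul, Pi.smul_apply, smul_eq_mul, mul_comm]

end lifting

/-- Every `p`-torsion Fontaine–Laffaille module `(M, φ)` over `k`
lifts to a `p`-torsion-free Fontaine–Laffaille module `(M̃, φ̃)` over `W(k)`: there is a
finitely generated graded `W(k)[v]`-module `M̃` with injective multiplication by `p`, a
Frobenius-semilinear bijection `φ̃ : M̃/(v−p)M̃ → M̃/(v−1)M̃`, and a graded isomorphism
`M̃/pM̃ ≅ M` compatible with the ring map `W(k)[v] → k[v]`, identifying the mod-`p`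
reduction of `φ̃` with `φ`. -/
theorem stmt_15 (p : ℕ) [Fact p.Prime] (k : Type u) [Field k] [CharP k p]
    [PerfectRing k p]
    (M : Type v) [AddCommGroup M] [Module k M] [Module (Polynomial k) M]
    [IsScalarTower k (Polynomial k) M] [Module.Finite (Polynomial k) M]
    (ℱ : ℤ → Submodule k M) (hint : DirectSum.IsInternal ℱ)
    (hdeg : ∀ i : ℤ, ∀ x ∈ ℱ i, (Polynomial.X : Polynomial k) • x ∈ ℱ (i - 1))
    (σk : k →+* k) (hσk : ∀ c : k, σk c = c ^ p)
    (φ : (M ⧸ fiberSub M (0 : k)) →ₛₗ[σk] (M ⧸ fiberSub M (1 : k)))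
    (hφ : Function.Bijective φ) :
    ∃ (D : GradedModuleData.{u, v} (WittVector p k))
      (φt : (D.carrier ⧸ fiberSub D.carrier ((p : WittVector p k))) →ₛₗ[
          (WittVector.frobenius : WittVector p k →+* WittVector p k)]
        (D.carrier ⧸ fiberSub D.carrier (1 : WittVector p k)))
      (e : (D.carrier ⧸ (Ideal.span {((p : ℕ) : Polynomial (WittVector p k))} •
          (⊤ : Submodule (Polynomial (WittVector p k)) D.carrier))) ≃+ M),
      Function.Injective
        (fun x : D.carrier => ((p : ℕ) : Polynomial (WittVector p k)) • x) ∧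
      Function.Bijective φt ∧
      (∀ (g : Polynomial (WittVector p k))
          (x : D.carrier ⧸ (Ideal.span {((p : ℕ) : Polynomial (WittVector p k))} •
            (⊤ : Submodule (Polynomial (WittVector p k)) D.carrier))),
        e (g • x) = (Polynomial.map (WittVector.ghostComponent 0) g) • e x) ∧
      (∀ (i : ℤ) (x : D.carrier), x ∈ D.grading i →
        e (Submodule.Quotient.mk x) ∈ ℱ i) ∧
      (∀ x y : D.carrier,
        φt (Submodule.Quotient.mk x) = Submodule.Quotient.mk y →
          φ (Submodule.Quotient.mk (e (Submodule.Quotient.mk x))) =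
            Submodule.Quotient.mk (e (Submodule.Quotient.mk y))) := by
  classical
  obtain ⟨n, b, d, hb⟩ := exists_graded_basis p ℱ hint hdeg σk hσk φ hφ
  have hsm := small_of_graded_basis p k M n b
  obtain ⟨D, _, _, _, _, ⟨B⟩⟩ := exists_small_model.{u, v} (WittVector p k) n
  have hσ : Function.Bijective σk := by
    have : (σk : k → k) = frobenius k p := by ext c; simp [hσk, frobenius_def]
    rw [this]
    exact bijective_frobenius k p
  let g0 : WittVector p k →+* k := WittVector.ghostComponent 0
  -- the matrix of `φ` and its lift
  let A : Matrix (Fin n) (Fin n) k :=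
    Matrix.of fun i j => evEquiv b 1 (φ ((evEquiv b 0).symm (Pi.single j 1))) i
  have hAφ : ∀ q, evEquiv b 1 (φ q) = A.mulVec (fun j => σk (evEquiv b 0 q j)) := fun q =>
    semilinear_eq_mulVec σk (evEquiv b 0) (evEquiv b 1) φ q
  have hA : IsUnit A := by
    rw [← Matrix.mulVec_surjective_iff_isUnit]
    intro w
    obtain ⟨q, hq⟩ := hφ.2 ((evEquiv b 1).symm w)
    refine ⟨fun j => σk (evEquiv b 0 q j), ?_⟩
    rw [← hAφ, hq, LinearEquiv.apply_symm_apply]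
  choose At hAt using fun i j => ghost_zero_surjective p k (A i j)
  have hAtA : (Matrix.of At).map g0 = A := by
    ext i j
    exact hAt i j
  have hAtu : IsUnit (Matrix.of At) := by
    rw [Matrix.isUnit_iff_isUnit_det]
    apply WittVector.isUnit_of_coeff_zero_ne_zero
    rw [← ghost_zero_apply]
    have h1 : g0 (Matrix.of At).det = A.det := by
      rw [RingHom.map_det, RingHom.mapMatrix_apply, hAtA]
    change g0 _ ≠ 0
    rw [h1]
    exact ((Matrix.isUnit_iff_isUnit_det _).1 hA).ne_zero
  refine ⟨{ carrier := D
            grading := freeGrading B d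
            internal := freeGrading_internal B d
            deg_X := freeGrading_X B d
            fin := Module.Finite.of_basis B }, frobLift B (Matrix.of At), redEquiv B b,
            ?_, frobLift_bijective B _ hAtu, ?_, ?_, ?_⟩
  · intro x y hxy
    apply B.repr.injective
    ext1 j
    have h1 := congrArg (fun z => B.repr z j) hxy
    simp only [map_smul, Finsupp.smul_apply, smul_eq_mul] at h1
    refine mul_left_cancel₀ ?_ h1
    rw [← Polynomial.C_eq_natCast, Ne, Polynomial.C_eq_zero]
    exact WittVector.p_nonzero p k
  · intro g x
    obtain ⟨x, rfl⟩ := Submodule.Quotient.mk_surjective _ x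
    exact (redMap p k B b).map_smulₛₗ g x
  · intro i x hx
    rw [redEquiv_mk]
    change ∑ j, ((B.repr x j).map g0) • b j ∈ ℱ i
    refine sum_mem fun j _ => ?_
    rw [((B.repr x j).map g0).as_sum_support, Finset.sum_smul]
    refine sum_mem fun m hm => ?_
    by_cases h : d j - m = i
    · subst h
      rw [← Polynomial.C_mul_X_pow_eq_monomial, mul_smul, C_smul_eq]
      exact Submodule.smul_mem _ _ (pow_smul_mem ℱ hdeg _ _ (hb j) m)
    · have h1 : (B.repr x j).coeff m = 0 := hx j m h
      rw [Polynomial.coeff_map, h1]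
      simp
  · intro x y hxy
    rw [redEquiv_mk, redEquiv_mk]
    apply (evEquiv b 1).injective
    rw [hAφ]
    have h1 : (Matrix.of At).mulVec (fun j => WittVector.frobenius
        (evEquiv B (p : WittVector p k) (Submodule.Quotient.mk x) j)) =
        evEquiv B 1 (Submodule.Quotient.mk y) := by
      rw [← LinearEquiv.symm_apply_eq]
      exact hxy
    ext i
    have h2 := congrArg g0 (congrFun h1 i)
    rw [evEquiv_mk] at h2 ⊢
    rw [redMap_repr, ← g0.map_one, Polynomial.eval_map_apply, ← h2, RingHom.map_mulVec, hAtA]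
    congr 2
    ext j
    simp only [Function.comp_apply, evEquiv_mk]
    rw [redMap_repr, hσk]
    change _ = g0 _
    rw [ghost_zero_frobenius]
    congr 1
    change _ = g0 _
    rw [← Polynomial.eval_map_apply, ghost_zero_p]
end

section
/- Let (M, φ) and (M', φ') be Fontaine–Laffaille modules over W(k), i.e., finitely generated ℤ-graded W[v]-modules equipped with σ-semilinear bijections φ: M/(v−p)M → M/(v−1)M and φ': M'/(v−p)M' → M'/(v−1)M'. Let f: M → M' be a grading-preserving W[v]-linear map compatible with the structures, i.e., φ' ∘ f̄_p = f̄_1 ∘ φ, where f̄_a: M/(v−a)M → M'/(v−a)M' denotes the induced map. Set N = ker f, a graded W[v]-submodule of M. Then the natural maps N/(v−p)N → ker(f̄_p) and N/(v−1)N → ker(f̄_1) are isomorphisms, and φ restricts to a σ-semilinear bijection N/(v−p)N → N/(v−1)N. In particular, N with the restricted structure is again a Fontaine–Laffaille module (kernels exist in the category MF(W(k)), which is abelian). -/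
/-- The map `M/(v−a)M → M'/(v−a)M'` induced by a `R[v]`-linear map `f : M → M'`. -/
noncomputable def inducedQuot {R M M' : Type*} [CommRing R] [AddCommGroup M] [Module (Polynomial R) M]
    [AddCommGroup M'] [Module (Polynomial R) M'] (f : M →ₗ[Polynomial R] M') (a : R) :
    (M ⧸ fiberSub M a) →ₗ[Polynomial R] (M' ⧸ fiberSub M' a) :=
  Submodule.mapQ _ _ f (by
    rw [fiberSub, fiberSub, ← Submodule.map_le_iff_le_comap, Submodule.map_smul'']
    exact Submodule.smul_mono le_rfl le_top)

section FLaux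

open Polynomial

set_option linter.unusedSectionVars false

variable {R : Type*} [CommRing R] {M : Type*} [AddCommGroup M] [Module R M] [Module R[X] M]
  [IsScalarTower R R[X] M]

theorem FL.mem_fiberSub {R : Type*} [CommRing R] {M : Type*} [AddCommGroup M] [Module R M]
    [Module R[X] M] [IsScalarTower R R[X] M] (c : R) (x : M) :
    x ∈ fiberSub M c ↔ ∃ y : M, (X : R[X]) • y - c • y = x := by
  rw [fiberSub, Submodule.ideal_span_singleton_smul, Submodule.mem_smul_pointwise_iff_exists]
  have : ∀ y : M, (X - C c : R[X]) • y = (X : R[X]) • y - c • y := by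
    intro y
    rw [sub_smul, ← algebraMap_smul R[X] c y, Polynomial.algebraMap_eq]
  simp [this]

theorem FL.span_le (S : Submodule R M) (hX : ∀ x ∈ S, (X : R[X]) • x ∈ S) (t : Set M)
    (ht : t ⊆ S) (x : M) (hx : x ∈ Submodule.span R[X] t) : x ∈ S := by
  induction hx using Submodule.span_induction with
  | mem x h => exact ht h
  | zero => exact S.zero_mem
  | add x y _ _ hx hy => exact S.add_mem hx hy
  | smul q x _ hx =>
    have hn : ∀ n : ℕ, (X ^ n : R[X]) • x ∈ S := by
      intro n
      induction n with
      | zero => simpa using hx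
      | succ n ih => rw [pow_succ', mul_smul]; exact hX _ ih
    induction q using Polynomial.induction_on' with
    | add p q hp hq => rw [add_smul]; exact S.add_mem hp hq
    | monomial n c =>
      rw [← Polynomial.smul_X_eq_monomial, smul_assoc]
      exact S.smul_mem _ (hn n)

/-- Homogeneous projections. -/
structure FL.GP (π : ℤ → M →ₗ[R] M) : Prop where
  sum : ∀ x, ∃ s : Finset ℤ, (∀ i ∉ s, π i x = 0) ∧ ∑ i ∈ s, π i x = x
  ortho : ∀ i j x, i ≠ j → π i (π j x) = 0
  idem : ∀ i x, π i (π i x) = π i x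
  hX : ∀ i x, π i ((X : R[X]) • x) = (X : R[X]) • π (i + 1) x

variable {π : ℤ → M →ₗ[R] M}

theorem FL.GP.ext (h : FL.GP π) (x : M) (hx : ∀ i, π i x = 0) : x = 0 := by
  obtain ⟨s, -, hs⟩ := h.sum x
  rw [← hs]; exact Finset.sum_eq_zero fun i _ => hx i

theorem FL.GP.bound (h : FL.GP π) (t : Finset M) :
    ∃ a b : ℤ, ∀ x ∈ t, ∀ i, (i < a ∨ b < i) → π i x = 0 := by
  classical
  choose s hs _ using h.sum
  obtain ⟨a, ha⟩ := (t.biUnion s).bddBelow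
  obtain ⟨b, hb⟩ := (t.biUnion s).bddAbove
  refine ⟨a, b, fun x hx i hi => hs x i fun his => ?_⟩
  have hm : i ∈ t.biUnion s := Finset.mem_biUnion.2 ⟨x, hx, his⟩
  have := ha hm
  have := hb hm
  omega

/-- Elements with components in degrees `≥ a`. -/
def FL.ge (π : ℤ → M →ₗ[R] M) (a : ℤ) : Submodule R M where
  carrier := {x | ∀ i < a, π i x = 0}
  add_mem' := by intro x y hx hy i hi; simp [hx i hi, hy i hi]
  zero_mem' := by intro i _; simp
  smul_mem' := by intro c x hx i hi; simp [hx i hi]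

/-- Elements with components in degrees `≤ b`. -/
def FL.le (π : ℤ → M →ₗ[R] M) (b : ℤ) : Submodule R M where
  carrier := {x | ∀ i, b < i → π i x = 0}
  add_mem' := by intro x y hx hy i hi; simp [hx i hi, hy i hi]
  zero_mem' := by intro i _; simp
  smul_mem' := by intro c x hx i hi; simp [hx i hi]

theorem FL.GP.gens (h : FL.GP π) [Module.Finite R[X] M] :
    ∃ (t : Finset M) (a b : ℤ), Submodule.span R[X] (t : Set M) = ⊤ ∧
      (∀ x ∈ t, ∀ i < a, π i x = 0) ∧ (∀ x, ∀ i, b < i → π i x = 0) := by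
  obtain ⟨t, ht⟩ := (Module.Finite.fg_top : (⊤ : Submodule R[X] M).FG)
  obtain ⟨a, b, hab⟩ := h.bound t
  refine ⟨t, a, b, ht, fun x hx i hi => hab x hx i (Or.inl hi), fun x => ?_⟩
  refine FL.span_le (FL.le π b) ?_ t ?_ x (ht ▸ Submodule.mem_top)
  · intro x hx i hi
    rw [h.hX, hx (i + 1) (by omega), smul_zero]
  · intro x hx i hi
    exact hab x hx i (Or.inr hi)

theorem FL.GP.kerX (h : FL.GP π) [Module.Finite R[X] M] [IsNoetherianRing R] :
    ∃ a : ℤ, ∀ x : M, (X : R[X]) • x = 0 → ∀ i < a, π i x = 0 := by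
  let K : Submodule R[X] M := LinearMap.ker (LinearMap.lsmul R[X] M X)
  have hK : ∀ x : M, x ∈ K ↔ (X : R[X]) • x = 0 := fun x => by simp [K]
  obtain ⟨t, ht⟩ := IsNoetherian.noetherian K
  obtain ⟨a, b, hab⟩ := h.bound t
  refine ⟨a, fun x hx => ?_⟩
  have := FL.span_le (FL.ge π a ⊓ K.restrictScalars R) ?_ t ?_ x (ht ▸ (hK x).2 hx)
  · exact this.1
  · rintro x ⟨_, hx⟩
    have hx' : (X : R[X]) • x = 0 := (hK x).1 hx
    rw [hx']; exact Submodule.zero_mem _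
  · intro x hx
    refine ⟨fun i hi => hab x hx i (Or.inl hi), ?_⟩
    show x ∈ K
    rw [← ht]; exact Submodule.subset_span hx

theorem FL.GP.ge_fg (h : FL.GP π) [Module.Finite R[X] M] [IsNoetherianRing R] (a : ℤ) :
    (FL.ge π a).FG := by
  classical
  obtain ⟨t, -, b, ht, -, hb⟩ := h.gens
  let P : M →ₗ[R] M := ∑ i ∈ Finset.Icc a b, π i
  have hP : ∀ x, P x = ∑ i ∈ Finset.Icc a b, π i x := fun x => by simp [P]
  let N : ℕ := (b - a + 1).toNat
  let G : Finset M := t.biUnion fun x => (Finset.range N).image fun j => P ((X ^ j : R[X]) • x)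
  have hXj : ∀ (j : ℕ) i x, π i ((X ^ j : R[X]) • x) = (X ^ j : R[X]) • π (i + j) x := by
    intro j
    induction j with
    | zero => simp
    | succ j ih =>
      intro i x
      rw [pow_succ', mul_smul, h.hX, ih, mul_smul]
      have e : i + 1 + (j : ℤ) = i + ((j + 1 : ℕ) : ℤ) := by push_cast; ring
      rw [e]
  have key : ∀ x, ∀ j : ℕ, P ((X ^ j : R[X]) • x) ∈ Submodule.span R (G : Set M) := by
    intro x
    let U : Submodule R M :=
      { carrier := {x | ∀ j : ℕ, P ((X ^ j : R[X]) • x) ∈ Submodule.span R (G : Set M)}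
        add_mem' := by
          intro x y hx hy j
          rw [smul_add, map_add]; exact Submodule.add_mem _ (hx j) (hy j)
        zero_mem' := by intro j; simp
        smul_mem' := by
          intro c x hx j
          rw [smul_comm, map_smul]; exact Submodule.smul_mem _ _ (hx j) }
    refine FL.span_le U ?_ t ?_ x (ht ▸ Submodule.mem_top)
    · intro x hx j
      rw [← mul_smul, ← pow_succ]; exact hx (j + 1)
    · intro x hx j
      by_cases hj : j < N
      · apply Submodule.subset_span
        simp only [G, Finset.coe_biUnion, Set.mem_iUnion, Finset.coe_image]
        exact ⟨x, hx, j, by simpa using hj, rfl⟩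
      · rw [hP, Finset.sum_eq_zero]
        · exact Submodule.zero_mem _
        · intro i hi
          rw [Finset.mem_Icc] at hi
          rw [hXj, hb x _ (by omega), smul_zero]
  have hfg : (Submodule.span R (G : Set M)).FG := ⟨G, rfl⟩
  refine Submodule.FG.of_le hfg ?_
  intro x hx
  have h0 := key x 0
  rw [pow_zero, one_smul] at h0
  convert h0
  rw [hP]
  have : x - ∑ i ∈ Finset.Icc a b, π i x = 0 := by
    apply h.ext
    intro j
    rw [map_sub, map_sum]
    by_cases hj : j ∈ Finset.Icc a b
    · rw [Finset.sum_eq_single_of_mem j hj (fun i _ hij => h.ortho _ _ _ hij.symm), h.idem,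
        sub_self]
    · rw [Finset.sum_eq_zero, sub_zero]
      · rw [Finset.mem_Icc] at hj
        by_cases hja : j < a
        · exact hx j hja
        · exact hb x j (by omega)
      · intro i hi
        exact h.ortho _ _ _ (fun e => hj (e ▸ hi))
  exact sub_eq_zero.1 this

theorem FL.GP.sub_one_inj (h : FL.GP π) [Module.Finite R[X] M]
    (x : M) (hx : (X : R[X]) • x - (1 : R) • x = 0) : x = 0 := by
  obtain ⟨t, -, b, ht, -, hb⟩ := h.gens
  rw [one_smul, sub_eq_zero] at hx
  apply h.ext
  have hs : ∀ n : ℕ, ∀ i, b - n < i → π i x = 0 := by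
    intro n
    induction n with
    | zero => intro i hi; exact hb x i (by simpa using hi)
    | succ n ih =>
      intro i hi
      rw [← hx, h.hX, ih (i + 1) (by push_cast at hi; omega), smul_zero]
  intro i
  exact hs (b - i + 1).toNat i (by omega)

/-- Length count in the torsion case. -/
theorem FL.GP.main (h : FL.GP π) [Module.Finite R[X] M] [IsNoetherianRing R] (p : R)
    (hfin : ∀ B : Submodule R M, B.FG → Module.length R B ≠ ⊤)
    (hlen : Module.length R (M ⧸ fiberSub M p) = Module.length R (M ⧸ fiberSub M (1 : R)))
    (x : M) (hx : (X : R[X]) • x - p • x = 0) : x = 0 := by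
  obtain ⟨t, a₀, b, ht, ha₀, hb⟩ := h.gens
  obtain ⟨a₁, ha₁⟩ := h.kerX
  let a : ℤ := min a₀ (a₁ - 1)
  have haa₀ : a ≤ a₀ := min_le_left _ _
  have haa₁ : a ≤ a₁ - 1 := min_le_right _ _
  have low : ∀ (c : R) (y : M), (X : R[X]) • y - c • y ∈ FL.ge π a → y ∈ FL.ge π (a + 1) := by
    intro c y hy
    obtain ⟨l, b', hl0⟩ := h.bound {y}
    have hl := hl0 y (by simp)
    have hs : ∀ n : ℕ, ∀ i, i < l + n → i ≤ a → π i y = 0 := by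
      intro n
      induction n with
      | zero => intro i hi _; exact hl i (Or.inl (by simpa using hi))
      | succ n ih =>
        intro i hi hia
        have h1 := hy (i - 1) (by omega)
        rw [map_sub, h.hX, map_smul, ih (i - 1) (by push_cast at hi; omega) (by omega), smul_zero,
          sub_zero, sub_add_cancel] at h1
        rw [← h.idem]
        exact ha₁ _ h1 i (by omega)
    intro i hi
    exact hs (i - l + 1).toNat i (by omega) (by omega)
  let A := FL.ge π (a + 1)
  let B := FL.ge π a
  let v : M →ₗ[R] M := (LinearMap.lsmul R[X] M X).restrictScalars R
  have hv : ∀ y, v y = (X : R[X]) • y := fun y => rfl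
  let T : R → M →ₗ[R] M := fun c => v - c • LinearMap.id
  have hT : ∀ c y, T c y = (X : R[X]) • y - c • y := fun c y => rfl
  have hAB : ∀ c, ∀ y ∈ A, T c y ∈ B := by
    intro c y hy i hi
    rw [hT, map_sub, h.hX, map_smul, hy (i + 1) (by omega), hy i (by omega)]
    simp
  let g : R → (A →ₗ[R] B) := fun c => (T c).restrict (hAB c)
  have hg : ∀ c y, ((g c y : B) : M) = (X : R[X]) • (y : M) - c • (y : M) := fun c y => rfl
  let q : (c : R) → B →ₗ[R] (M ⧸ fiberSub M c) := fun c =>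
    ((fiberSub M c).mkQ.restrictScalars R).comp B.subtype
  have hq : ∀ c y, q c y = (fiberSub M c).mkQ (y : M) := fun c y => rfl
  have hqs : ∀ c, Function.Surjective (q c) := by
    intro c z
    obtain ⟨m, rfl⟩ := Submodule.mkQ_surjective _ z
    have := FL.span_le (B ⊔ (fiberSub M c).restrictScalars R) ?_ t ?_ m (ht ▸ Submodule.mem_top)
    · obtain ⟨y, hy, z, hz, rfl⟩ := Submodule.mem_sup.1 this
      refine ⟨⟨y, hy⟩, ?_⟩
      rw [hq, map_add]
      have : (fiberSub M c).mkQ z = 0 := by simpa using hz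
      rw [this, add_zero]
    · intro m hm
      have : (X : R[X]) • m = c • m + ((X : R[X]) • m - c • m) := by abel
      rw [this]
      refine Submodule.add_mem _ (Submodule.smul_mem _ _ hm) (Submodule.mem_sup_right ?_)
      exact (FL.mem_fiberSub c _).2 ⟨m, rfl⟩
    · intro m hm
      exact Submodule.mem_sup_left fun i hi => ha₀ m hm i (by omega)
  have hex : ∀ c, LinearMap.ker (q c) = LinearMap.range (g c) := by
    intro c
    ext y
    rw [LinearMap.mem_ker, hq, Submodule.mkQ_apply, Submodule.Quotient.mk_eq_zero,
      FL.mem_fiberSub, LinearMap.mem_range]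
    constructor
    · rintro ⟨z, hz⟩
      exact ⟨⟨z, low c z (hz ▸ y.2)⟩, Subtype.ext hz⟩
    · rintro ⟨z, hz⟩
      exact ⟨z, by rw [← hz, hg]⟩
  have len : ∀ c, Module.length R A + Module.length R (M ⧸ fiberSub M c) =
      Module.length R B + Module.length R (LinearMap.ker (g c)) := by
    intro c
    rw [Module.length_eq_add_of_exact (LinearMap.ker (g c)).subtype (g c).rangeRestrict
        (Submodule.subtype_injective _) (LinearMap.surjective_rangeRestrict _)
        (by rw [LinearMap.exact_iff]; simp),
      Module.length_eq_add_of_exact (LinearMap.range (g c)).subtype (q c)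
        (Submodule.subtype_injective _) (hqs c)
        (by rw [LinearMap.exact_iff]; simp [hex])]
    ring
  have h1 : LinearMap.ker (g 1) = ⊥ := by
    rw [LinearMap.ker_eq_bot']
    intro y hy
    apply Subtype.ext
    apply h.sub_one_inj
    rw [← hg, hy]; rfl
  have e1 := len 1
  have e2 := len p
  rw [h1, Module.length_bot, add_zero] at e1
  rw [hlen, e1] at e2
  have hBt : Module.length R B ≠ ⊤ := hfin B (h.ge_fg a)
  have hK : Module.length R (LinearMap.ker (g p)) = 0 := by
    have : Module.length R B + 0 = Module.length R B + Module.length R (LinearMap.ker (g p)) := by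
      rw [add_zero]; exact e2
    exact (ENat.add_right_injective_of_ne_top hBt this).symm
  rw [Module.length_eq_zero_iff] at hK
  have hxA : x ∈ A := low p x (by rw [hx]; exact Submodule.zero_mem _)
  have hxK : (⟨x, hxA⟩ : A) ∈ LinearMap.ker (g p) := by
    rw [LinearMap.mem_ker]; exact Subtype.ext hx
  have := Subsingleton.elim (⟨_, hxK⟩ : LinearMap.ker (g p)) 0
  simpa using congrArg (fun z : LinearMap.ker (g p) => ((z : A) : M)) this

theorem FL.finLen [IsDomain R] [IsDiscreteValuationRing R] {S : Type*} [AddCommGroup S] [Module R S]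
    [Module.Finite R S] (r : R) (hr : r ≠ 0) (hS : ∀ x : S, r • x = 0) :
    Module.length R S ≠ ⊤ := by
  have h1 : IsFiniteLength R (R ⧸ Ideal.span {r}) :=
    isFiniteLength_quotient_span_singleton R (mem_nonZeroDivisors_of_ne_zero hr)
  rw [isFiniteLength_iff_isNoetherian_isArtinian] at h1
  obtain ⟨h1, h2⟩ := h1
  obtain ⟨n, s, hs⟩ := Module.Finite.exists_fin (R := R) (M := S)
  let l : S → (R ⧸ Ideal.span {r}) →ₗ[R] S := fun x =>
    (Ideal.span {r}).liftQ (LinearMap.toSpanSingleton R S x) (by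
      rw [Ideal.span, Submodule.span_le]
      rintro _ rfl
      simp [hS])
  let L : (Fin n → (R ⧸ Ideal.span {r})) →ₗ[R] S := ∑ i, (l (s i)).comp (LinearMap.proj i)
  have hL : Function.Surjective L := by
    rw [← LinearMap.range_eq_top, ← top_le_iff, ← hs, Submodule.span_le]
    rintro _ ⟨i, rfl⟩
    refine ⟨Pi.single i (Submodule.Quotient.mk 1), ?_⟩
    simp only [L, LinearMap.sum_apply, LinearMap.comp_apply, LinearMap.proj_apply]
    rw [Finset.sum_eq_single_of_mem i (Finset.mem_univ _)]
    · rw [Pi.single_eq_same]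
      show LinearMap.toSpanSingleton R S (s i) 1 = s i
      simp
    · intro j _ hj
      rw [Pi.single_eq_of_ne hj, map_zero]
  have : IsArtinian R S := isArtinian_of_surjective _ L hL
  exact Module.length_ne_top

/-- Projections on a quotient. -/
noncomputable def FL.qproj (π : ℤ → M →ₗ[R] M) (D : Submodule R[X] M)
    (hD : ∀ i, ∀ x ∈ D, π i x ∈ D) (i : ℤ) : (M ⧸ D) →ₗ[R] (M ⧸ D) :=
  (Submodule.Quotient.restrictScalarsEquiv R D).toLinearMap ∘ₗ
    (Submodule.mapQ (D.restrictScalars R) (D.restrictScalars R) (π i) (hD i)) ∘ₗ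
    (Submodule.Quotient.restrictScalarsEquiv R D).symm.toLinearMap

theorem FL.qproj_mk (π : ℤ → M →ₗ[R] M) (D : Submodule R[X] M)
    (hD : ∀ i, ∀ x ∈ D, π i x ∈ D) (i : ℤ) (x : M) :
    FL.qproj π D hD i (D.mkQ x) = D.mkQ (π i x) := rfl

theorem FL.GP.quot (h : FL.GP π) (D : Submodule R[X] M) (hD : ∀ i, ∀ x ∈ D, π i x ∈ D) :
    FL.GP (FL.qproj π D hD) where
  sum := by
    intro x
    obtain ⟨x, rfl⟩ := D.mkQ_surjective x
    obtain ⟨s, hs, hs'⟩ := h.sum x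
    refine ⟨s, fun i hi => ?_, ?_⟩
    · rw [FL.qproj_mk, hs i hi, map_zero]
    · simp only [FL.qproj_mk]
      rw [← map_sum, hs']
  ortho := by
    intro i j x hij
    obtain ⟨x, rfl⟩ := D.mkQ_surjective x
    rw [FL.qproj_mk, FL.qproj_mk, h.ortho _ _ _ hij, map_zero]
  idem := by
    intro i x
    obtain ⟨x, rfl⟩ := D.mkQ_surjective x
    rw [FL.qproj_mk, FL.qproj_mk, h.idem]
  hX := by
    intro i x
    obtain ⟨x, rfl⟩ := D.mkQ_surjective x
    rw [← map_smul, FL.qproj_mk, FL.qproj_mk, h.hX, map_smul]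

theorem FL.length_quot (D : Submodule R[X] M) (c : R) :
    Module.length R ((M ⧸ D) ⧸ fiberSub (M ⧸ D) c) =
      Order.coheight ((D.map (fiberSub M c).mkQ).restrictScalars R) := by
  have e : fiberSub (M ⧸ D) c = (fiberSub M c).map D.mkQ := by
    rw [fiberSub, fiberSub, Submodule.map_smul'', Submodule.map_top, Submodule.range_mkQ]
  rw [← Module.length_quotient]
  let e1 : ((M ⧸ D) ⧸ fiberSub (M ⧸ D) c) ≃ₗ[R[X]] ((M ⧸ fiberSub M c) ⧸ D.map (fiberSub M c).mkQ) :=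
    Submodule.quotEquivOfEq _ _ e ≪≫ₗ Submodule.quotientQuotientEquivQuotientSup D (fiberSub M c)
      ≪≫ₗ Submodule.quotEquivOfEq _ _ (sup_comm _ _)
      ≪≫ₗ (Submodule.quotientQuotientEquivQuotientSup (fiberSub M c) D).symm
  exact (LinearEquiv.length_eq (e1.restrictScalars R)).trans
    (LinearEquiv.length_eq (Submodule.Quotient.restrictScalarsEquiv R _).symm)

theorem FL.key [IsDomain R] [IsDiscreteValuationRing R] (h : FL.GP π) [Module.Finite R[X] M]
    (p : R) (hp0 : p ≠ 0) (hpm : ¬ IsUnit p) (σ : R →+* R) [RingHomSurjective σ] (hσ : σ p = p)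
    (φ : (M ⧸ fiberSub M p) →ₛₗ[σ] (M ⧸ fiberSub M (1 : R))) (hφ : Function.Bijective φ)
    (D : Submodule R[X] M) (hD : ∀ i, ∀ x ∈ D, π i x ∈ D)
    (h1 : ∀ d ∈ D, ∃ e ∈ D, φ ((fiberSub M p).mkQ d) = (fiberSub M (1 : R)).mkQ e)
    (h2 : ∀ e ∈ D, ∃ d ∈ D, φ ((fiberSub M p).mkQ d) = (fiberSub M (1 : R)).mkQ e)
    (x : M) (hx : (X : R[X]) • x - p • x ∈ D) : x ∈ D := by
  let I : Ideal R[X] := Ideal.span {C p}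
  have hI : ∀ {N : Type _} [AddCommGroup N] [Module R N] [Module R[X] N] [IsScalarTower R R[X] N]
      (n : ℕ) (y : N), y ∈ I ^ n • (⊤ : Submodule R[X] N) ↔ ∃ m : N, p ^ n • m = y := by
    intro N _ _ _ _ n y
    have : ∀ m : N, (C p ^ n : R[X]) • m = p ^ n • m := by
      intro m
      rw [← C_pow, ← algebraMap_smul R[X] (p ^ n) m, Polynomial.algebraMap_eq]
    rw [Ideal.span_singleton_pow, Submodule.ideal_span_singleton_smul,
      Submodule.mem_smul_pointwise_iff_exists]
    simp [this]
  have step : ∀ n : ℕ, x ∈ D ⊔ I ^ n • (⊤ : Submodule R[X] M) := by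
    intro n
    let D' : Submodule R[X] M := D ⊔ I ^ n • (⊤ : Submodule R[X] M)
    have hmem : ∀ y, y ∈ D' ↔ ∃ d ∈ D, ∃ m : M, d + p ^ n • m = y := by
      intro y
      rw [Submodule.mem_sup]
      constructor
      · rintro ⟨d, hd, z, hz, rfl⟩
        obtain ⟨m, rfl⟩ := (hI n z).1 hz
        exact ⟨d, hd, m, rfl⟩
      · rintro ⟨d, hd, m, rfl⟩
        exact ⟨d, hd, _, (hI n _).2 ⟨m, rfl⟩, rfl⟩
    have hD' : ∀ i, ∀ x ∈ D', π i x ∈ D' := by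
      intro i y hy
      obtain ⟨d, hd, m, rfl⟩ := (hmem y).1 hy
      exact (hmem _).2 ⟨π i d, hD i d hd, π i m, by simp⟩
    have hpn : p ^ n ≠ 0 := pow_ne_zero _ hp0
    have htors : ∀ y : M ⧸ D', p ^ n • y = 0 := by
      intro y
      obtain ⟨y, rfl⟩ := D'.mkQ_surjective y
      rw [← LinearMap.map_smul_of_tower, Submodule.mkQ_apply, Submodule.Quotient.mk_eq_zero]
      exact (hmem _).2 ⟨0, zero_mem _, y, by simp⟩
    have hmk : ∀ (c : R) (m : M), (fiberSub M c).mkQ (p ^ n • m) = p ^ n • (fiberSub M c).mkQ m :=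
      fun c m => LinearMap.map_smul_of_tower _ _ _
    have hφn : ∀ m, φ (p ^ n • m) = p ^ n • φ m := by
      intro m
      rw [LinearMap.map_smulₛₗ, map_pow, hσ]
    have hmap : ((D'.map (fiberSub M p).mkQ).restrictScalars R).map φ =
        (D'.map (fiberSub M (1 : R)).mkQ).restrictScalars R := by
      ext z
      constructor
      · rintro ⟨_, ⟨y, hy, rfl⟩, rfl⟩
        obtain ⟨d, hd, m, rfl⟩ := (hmem y).1 hy
        obtain ⟨e, he, hde⟩ := h1 d hd
        obtain ⟨m', hm'⟩ := Submodule.mkQ_surjective _ (φ ((fiberSub M p).mkQ m))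
        refine ⟨e + p ^ n • m', (hmem _).2 ⟨e, he, m', rfl⟩, ?_⟩
        rw [map_add, map_add, map_add, hmk, hmk, hφn, hde, hm']
      · rintro ⟨y, hy, rfl⟩
        obtain ⟨e, he, m', rfl⟩ := (hmem y).1 hy
        obtain ⟨d, hd, hde⟩ := h2 e he
        obtain ⟨m, hm⟩ := hφ.2 ((fiberSub M (1 : R)).mkQ m')
        obtain ⟨m, rfl⟩ := Submodule.mkQ_surjective _ m
        refine ⟨_, ⟨d + p ^ n • m, (hmem _).2 ⟨d, hd, m, rfl⟩, rfl⟩, ?_⟩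
        rw [map_add, map_add, map_add, hmk, hmk, hφn, hde, hm]
    have hlen : Module.length R ((M ⧸ D') ⧸ fiberSub (M ⧸ D') p) =
        Module.length R ((M ⧸ D') ⧸ fiberSub (M ⧸ D') (1 : R)) := by
      rw [FL.length_quot, FL.length_quot, ← hmap]
      exact (Order.coheight_orderIso (Submodule.orderIsoMapComapOfBijective φ hφ) _).symm
    have := (h.quot D' hD').main p (fun B hB => by
        have : Module.Finite R B := Module.Finite.iff_fg.2 hB
        exact FL.finLen (p ^ n) hpn fun y => Subtype.ext (htors y)) hlen (D'.mkQ x) (by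
        rw [← map_smul, ← LinearMap.map_smul_of_tower, ← map_sub, Submodule.mkQ_apply,
          Submodule.Quotient.mk_eq_zero]
        exact Submodule.mem_sup_left hx)
    simpa using this
  let x' : M ⧸ D := D.mkQ x
  have hx' : (X : R[X]) • x' = p • x' := by
    rw [← sub_eq_zero, ← map_smul, ← LinearMap.map_smul_of_tower, ← map_sub, Submodule.mkQ_apply,
          Submodule.Quotient.mk_eq_zero]
    exact hx
  have hinf : x' ∈ (⨅ i : ℕ, I ^ i • (⊤ : Submodule R[X] (M ⧸ D))) := by
    rw [Submodule.mem_iInf]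
    intro n
    obtain ⟨d, hd, z, hz, hdz⟩ := Submodule.mem_sup.1 (step n)
    obtain ⟨m, rfl⟩ := (hI n z).1 hz
    refine (hI n _).2 ⟨D.mkQ m, ?_⟩
    have hd0 : D.mkQ d = 0 := by simpa using hd
    show _ = D.mkQ x
    rw [← hdz, map_add, hd0, zero_add, LinearMap.map_smul_of_tower]
  obtain ⟨⟨r, hr⟩, hrx⟩ := (Ideal.mem_iInf_smul_pow_eq_bot_iff I x').1 hinf
  obtain ⟨s, rfl⟩ := Ideal.mem_span_singleton'.1 hr
  have hev : ∀ q : R[X], q • x' = (q.eval p) • x' := by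
    intro q
    have hn : ∀ n : ℕ, (X ^ n : R[X]) • x' = p ^ n • x' := by
      intro n
      induction n with
      | zero => simp
      | succ n ih => rw [pow_succ', mul_smul, ih, smul_comm, hx', ← mul_smul, ← pow_succ]
    induction q using Polynomial.induction_on' with
    | add f g hf hg => rw [add_smul, hf, hg, eval_add, add_smul]
    | monomial n c =>
      rw [eval_monomial, ← Polynomial.smul_X_eq_monomial, smul_assoc, hn, mul_smul]
  have hrx' : (s * C p) • x' = x' := hrx
  rw [hev, eval_mul, eval_C] at hrx'
  have hu : IsUnit (1 - s.eval p * p) := by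
    apply IsLocalRing.isUnit_one_sub_self_of_mem_nonunits
    rw [mem_nonunits_iff]
    intro hu
    exact hpm (isUnit_of_mul_isUnit_right hu)
  have h0 : (1 - s.eval p * p) • x' = 0 := by rw [sub_smul, one_smul, hrx', sub_self]
  have hx0 : x' = 0 := (hu.smul_eq_zero).1 h0
  simpa [x'] using hx0

theorem FL.exists_gp (ℱ : ℤ → Submodule R M) (hint : DirectSum.IsInternal ℱ)
    (hdeg : ∀ i : ℤ, ∀ x ∈ ℱ i, (X : R[X]) • x ∈ ℱ (i - 1)) :
    ∃ π : ℤ → M →ₗ[R] M, FL.GP π ∧ (∀ i x, π i x ∈ ℱ i) ∧ (∀ i, ∀ x ∈ ℱ i, π i x = x) ∧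
      (∀ i j, i ≠ j → ∀ x ∈ ℱ j, π i x = 0) := by
  classical
  letI := hint.chooseDecomposition
  let π : ℤ → M →ₗ[R] M := fun i =>
    (ℱ i).subtype ∘ₗ DirectSum.component R ℤ (fun i => ℱ i) i ∘ₗ
      (DirectSum.decomposeLinearEquiv ℱ).toLinearMap
  have hπ : ∀ i x, π i x = (DirectSum.decompose ℱ x i : M) := fun i x => rfl
  have hmem : ∀ i x, π i x ∈ ℱ i := fun i x => by rw [hπ]; exact Subtype.prop _
  have hself : ∀ i, ∀ x ∈ ℱ i, π i x = x := fun i x hx => by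
    rw [hπ, DirectSum.decompose_of_mem_same ℱ hx]
  have hne : ∀ i j, i ≠ j → ∀ x ∈ ℱ j, π i x = 0 := fun i j hij x hx => by
    rw [hπ, DirectSum.decompose_of_mem_ne ℱ hx hij.symm]
  refine ⟨π, ⟨?_, ?_, ?_, ?_⟩, hmem, hself, hne⟩
  · intro x
    refine ⟨(DirectSum.decompose ℱ x).support, fun i hi => ?_, ?_⟩
    · rw [hπ]; simpa using hi
    · exact DirectSum.sum_support_decompose ℱ x
  · intro i j x hij
    exact hne i j hij _ (hmem j x)
  · intro i x
    exact hself i _ (hmem i x)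
  · intro i x
    have hx : x ∈ ⨆ i, ℱ i := by rw [hint.submodule_iSup_eq_top]; trivial
    induction hx using Submodule.iSup_induction' with
    | mem j x hx =>
      by_cases hij : i = j - 1
      · subst hij
        rw [hself _ _ (hdeg j x hx), sub_add_cancel, hself _ _ hx]
      · rw [hne _ _ hij _ (hdeg j x hx), hne _ j (by omega) x hx, smul_zero]
    | zero => simp
    | add x y _ _ hx hy => simp only [smul_add, map_add, hx, hy]

variable {M' : Type*} [AddCommGroup M'] [Module R M'] [Module R[X] M'] [IsScalarTower R R[X] M']

theorem FL.ker_iso (f : M →ₗ[R[X]] M') (c : R)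
    (hinj : ∀ y : M', (X : R[X]) • y - c • y = 0 → y = 0)
    (hcok : ∀ y : M', (X : R[X]) • y - c • y ∈ LinearMap.range f → y ∈ LinearMap.range f) :
    Function.Injective (inducedQuot (LinearMap.ker f).subtype c) ∧
      Set.range (inducedQuot (LinearMap.ker f).subtype c) = {x | inducedQuot f c x = 0} := by
  have hmk : ∀ m, inducedQuot f c ((fiberSub M c).mkQ m) = (fiberSub M' c).mkQ (f m) :=
    fun m => rfl
  have hmk' : ∀ m, inducedQuot (LinearMap.ker f).subtype c ((fiberSub (LinearMap.ker f) c).mkQ m) =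
    (fiberSub M c).mkQ (m : M) := fun m => rfl
  have hfs : ∀ y : M, f ((X : R[X]) • y - c • y) = (X : R[X]) • f y - c • f y := by
    intro y
    rw [map_sub, map_smul, LinearMap.map_smul_of_tower]
  constructor
  · rw [injective_iff_map_eq_zero]
    intro n hn
    obtain ⟨n, rfl⟩ := Submodule.mkQ_surjective _ n
    rw [hmk', Submodule.mkQ_apply, Submodule.Quotient.mk_eq_zero, FL.mem_fiberSub] at hn
    rw [Submodule.mkQ_apply, Submodule.Quotient.mk_eq_zero, FL.mem_fiberSub]
    obtain ⟨y, hy⟩ := hn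
    refine ⟨⟨y, ?_⟩, Subtype.ext hy⟩
    apply hinj
    rw [← hfs, hy]
    exact n.2
  · ext z
    constructor
    · rintro ⟨n, rfl⟩
      obtain ⟨n, rfl⟩ := Submodule.mkQ_surjective _ n
      show _ = _
      rw [hmk', hmk, LinearMap.mem_ker.1 n.2, map_zero]
    · intro hz
      obtain ⟨m, rfl⟩ := Submodule.mkQ_surjective _ z
      have hz' : inducedQuot f c ((fiberSub M c).mkQ m) = 0 := hz
      rw [hmk, Submodule.mkQ_apply, Submodule.Quotient.mk_eq_zero, FL.mem_fiberSub] at hz'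
      obtain ⟨y, hy⟩ := hz'
      obtain ⟨w, rfl⟩ := hcok y (hy ▸ ⟨m, rfl⟩)
      refine ⟨(fiberSub (LinearMap.ker f) c).mkQ ⟨m - ((X : R[X]) • w - c • w), ?_⟩, ?_⟩
      · rw [LinearMap.mem_ker, map_sub, hfs, hy, sub_self]
      · rw [hmk']
        show (fiberSub M c).mkQ (m - ((X : R[X]) • w - c • w)) = _
        rw [map_sub, sub_eq_self, Submodule.mkQ_apply, Submodule.Quotient.mk_eq_zero,
          FL.mem_fiberSub]
        exact ⟨w, rfl⟩

end FLaux

/-- Kernels of morphisms of Fontaine–Laffaille modules over `W(k)` are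
again Fontaine–Laffaille modules: for a morphism `f : (M,φ) → (M',φ')` compatible with
the gradings and the Frobenii, `N = ker f` is a graded submodule, the natural maps
`N/(v−p)N → ker f̄_p` and `N/(v−1)N → ker f̄_1` are isomorphisms, and `φ` restricts to a
σ-semilinear bijection `N/(v−p)N → N/(v−1)N`. -/
theorem stmt_16 (p : ℕ) [Fact p.Prime] (k : Type*) [Field k] [CharP k p] [PerfectRing k p]
    (M : Type*) [AddCommGroup M] [Module (WittVector p k) M]
    [Module (Polynomial (WittVector p k)) M]
    [IsScalarTower (WittVector p k) (Polynomial (WittVector p k)) M]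
    [Module.Finite (Polynomial (WittVector p k)) M]
    (M' : Type*) [AddCommGroup M'] [Module (WittVector p k) M']
    [Module (Polynomial (WittVector p k)) M']
    [IsScalarTower (WittVector p k) (Polynomial (WittVector p k)) M']
    [Module.Finite (Polynomial (WittVector p k)) M']
    (ℱ : ℤ → Submodule (WittVector p k) M) (hint : DirectSum.IsInternal ℱ)
    (hdeg : ∀ i : ℤ, ∀ x ∈ ℱ i,
      (Polynomial.X : Polynomial (WittVector p k)) • x ∈ ℱ (i - 1))
    (ℱ' : ℤ → Submodule (WittVector p k) M') (hint' : DirectSum.IsInternal ℱ')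
    (hdeg' : ∀ i : ℤ, ∀ x ∈ ℱ' i,
      (Polynomial.X : Polynomial (WittVector p k)) • x ∈ ℱ' (i - 1))
    (φ : (M ⧸ fiberSub M ((p : WittVector p k))) →ₛₗ[
          (WittVector.frobenius : WittVector p k →+* WittVector p k)]
        (M ⧸ fiberSub M (1 : WittVector p k)))
    (hφ : Function.Bijective φ)
    (φ' : (M' ⧸ fiberSub M' ((p : WittVector p k))) →ₛₗ[
          (WittVector.frobenius : WittVector p k →+* WittVector p k)]
        (M' ⧸ fiberSub M' (1 : WittVector p k)))
    (hφ' : Function.Bijective φ')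
    (f : M →ₗ[Polynomial (WittVector p k)] M')
    (hgrade : ∀ i : ℤ, ∀ x ∈ ℱ i, f x ∈ ℱ' i)
    (hcompat : ∀ x : M ⧸ fiberSub M ((p : WittVector p k)),
      φ' (inducedQuot f ((p : WittVector p k)) x) = inducedQuot f 1 (φ x)) :
    (Submodule.restrictScalars (WittVector p k) (LinearMap.ker f) =
      ⨆ i : ℤ, (ℱ i ⊓ Submodule.restrictScalars (WittVector p k) (LinearMap.ker f))) ∧
    (Function.Injective
        (inducedQuot (LinearMap.ker f).subtype ((p : WittVector p k))) ∧
      Set.range (inducedQuot (LinearMap.ker f).subtype ((p : WittVector p k))) =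
        {x | inducedQuot f ((p : WittVector p k)) x = 0}) ∧
    (Function.Injective (inducedQuot (LinearMap.ker f).subtype (1 : WittVector p k)) ∧
      Set.range (inducedQuot (LinearMap.ker f).subtype (1 : WittVector p k)) =
        {x | inducedQuot f (1 : WittVector p k) x = 0}) ∧
    ∃ ψ : ((LinearMap.ker f) ⧸ fiberSub (LinearMap.ker f) ((p : WittVector p k))) →ₛₗ[
          (WittVector.frobenius : WittVector p k →+* WittVector p k)]
        ((LinearMap.ker f) ⧸ fiberSub (LinearMap.ker f) (1 : WittVector p k)),
      Function.Bijective ψ ∧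
        ∀ x, inducedQuot (LinearMap.ker f).subtype (1 : WittVector p k) (ψ x) =
          φ (inducedQuot (LinearMap.ker f).subtype ((p : WittVector p k)) x) := by
  classical
  obtain ⟨π, hπ, hπm, hπs, hπn⟩ := FL.exists_gp ℱ hint hdeg
  obtain ⟨π', hπ', hπm', hπs', hπn'⟩ := FL.exists_gp ℱ' hint' hdeg'
  have hfπ : ∀ i x, f (π i x) = π' i (f x) := by
    intro i x
    have hx : x ∈ ⨆ i, ℱ i := by rw [hint.submodule_iSup_eq_top]; trivial
    induction hx using Submodule.iSup_induction' with
    | mem j x hx =>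
      by_cases hij : i = j
      · subst hij
        rw [hπs _ _ hx, hπs' _ _ (hgrade _ _ hx)]
      · rw [hπn _ _ hij _ hx, hπn' _ _ hij _ (hgrade _ _ hx), map_zero]
    | zero => simp
    | add x y _ _ hx hy => simp only [map_add, hx, hy]
  have hp0 : (p : WittVector p k) ≠ 0 := (WittVector.irreducible p).ne_zero
  have hpu : ¬ IsUnit (p : WittVector p k) := (WittVector.irreducible p).not_isUnit
  haveI : RingHomSurjective (WittVector.frobenius : WittVector p k →+* WittVector p k) :=
    ⟨(WittVector.frobenius_bijective p k).2⟩
  have hσ : (WittVector.frobenius : WittVector p k →+* WittVector p k) (p : WittVector p k) = p :=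
    map_natCast _ p
  have hstab : ∀ i, ∀ x ∈ LinearMap.range f, π' i x ∈ LinearMap.range f := by
    rintro i _ ⟨x, rfl⟩
    exact ⟨π i x, hfπ i x⟩
  have hinj : ∀ y : M', (Polynomial.X : Polynomial (WittVector p k)) • y -
      (p : WittVector p k) • y = 0 → y = 0 := by
    intro y hy
    have := FL.key hπ' (p : WittVector p k) hp0 hpu _ hσ φ' hφ' ⊥
      (by rintro i x hx; rw [Submodule.mem_bot] at hx ⊢; rw [hx, map_zero])
      (by rintro d hd; rw [Submodule.mem_bot] at hd; exact ⟨0, zero_mem _, by simp [hd]⟩)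
      (by rintro d hd; rw [Submodule.mem_bot] at hd; exact ⟨0, zero_mem _, by simp [hd]⟩)
      y (by rw [Submodule.mem_bot]; exact hy)
    simpa using this
  have hcok : ∀ y : M', (Polynomial.X : Polynomial (WittVector p k)) • y -
      (p : WittVector p k) • y ∈ LinearMap.range f → y ∈ LinearMap.range f := by
    intro y hy
    refine FL.key hπ' (p : WittVector p k) hp0 hpu _ hσ φ' hφ' (LinearMap.range f) hstab ?_ ?_ y hy
    · rintro _ ⟨m, rfl⟩
      obtain ⟨m', hm'⟩ := Submodule.mkQ_surjective _ (φ ((fiberSub M (p : WittVector p k)).mkQ m))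
      refine ⟨f m', ⟨m', rfl⟩, ?_⟩
      have := hcompat ((fiberSub M (p : WittVector p k)).mkQ m)
      rw [← hm'] at this
      exact this
    · rintro _ ⟨m', rfl⟩
      obtain ⟨m, hm⟩ := hφ.2 ((fiberSub M (1 : WittVector p k)).mkQ m')
      obtain ⟨m, rfl⟩ := Submodule.mkQ_surjective _ m
      refine ⟨f m, ⟨m, rfl⟩, ?_⟩
      have := hcompat ((fiberSub M (p : WittVector p k)).mkQ m)
      rw [hm] at this
      exact this
  have hinj1 : ∀ y : M', (Polynomial.X : Polynomial (WittVector p k)) • y -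
      (1 : WittVector p k) • y = 0 → y = 0 := fun y hy => hπ'.sub_one_inj y hy
  have hcok1 : ∀ y : M', (Polynomial.X : Polynomial (WittVector p k)) • y -
      (1 : WittVector p k) • y ∈ LinearMap.range f → y ∈ LinearMap.range f := by
    intro y hy
    have := (hπ'.quot _ hstab).sub_one_inj ((LinearMap.range f).mkQ y) (by
      rw [← map_smul, ← LinearMap.map_smul_of_tower, ← map_sub, Submodule.mkQ_apply,
          Submodule.Quotient.mk_eq_zero]
      exact hy)
    rwa [Submodule.mkQ_apply, Submodule.Quotient.mk_eq_zero] at this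
  obtain ⟨ip, rp⟩ := FL.ker_iso f (p : WittVector p k) hinj hcok
  obtain ⟨i1, r1⟩ := FL.ker_iso f (1 : WittVector p k) hinj1 hcok1
  refine ⟨?_, ⟨ip, rp⟩, ⟨i1, r1⟩, ?_⟩
  · apply le_antisymm
    · intro x hx
      obtain ⟨s, -, hs⟩ := hπ.sum x
      rw [← hs]
      refine Submodule.sum_mem _ fun i _ => Submodule.mem_iSup_of_mem i ⟨hπm i x, ?_⟩
      show π i x ∈ LinearMap.ker f
      have hx' : f x = 0 := hx
      rw [LinearMap.mem_ker, hfπ, hx', map_zero]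
    · exact iSup_le fun i => inf_le_right
  · have hex : ∀ x, ∃ y, inducedQuot (LinearMap.ker f).subtype (1 : WittVector p k) y =
        φ (inducedQuot (LinearMap.ker f).subtype ((p : WittVector p k)) x) := by
      intro x
      have hx : inducedQuot (LinearMap.ker f).subtype ((p : WittVector p k)) x ∈
          {x | inducedQuot f ((p : WittVector p k)) x = 0} := rp ▸ ⟨x, rfl⟩
      have hy : φ (inducedQuot (LinearMap.ker f).subtype ((p : WittVector p k)) x) ∈
          {x | inducedQuot f (1 : WittVector p k) x = 0} := by
        show inducedQuot f 1 _ = 0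
        rw [← hcompat]
        have hx' : inducedQuot f (p : WittVector p k) _ = 0 := hx
        rw [hx', map_zero]
      rw [← r1] at hy
      exact hy
    choose ψ hψ using hex
    refine ⟨⟨⟨ψ, ?_⟩, ?_⟩, ⟨?_, ?_⟩, hψ⟩
    · intro x y
      apply i1
      rw [map_add, hψ, hψ, hψ, map_add, map_add]
    · intro c x
      apply i1
      show inducedQuot _ _ (ψ (c • x)) = inducedQuot _ _ (_ • ψ x)
      rw [LinearMap.map_smul_of_tower, hψ, hψ, LinearMap.map_smul_of_tower,
        LinearMap.map_smulₛₗ]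
    · intro x y hxy
      have hxy' : ψ x = ψ y := hxy
      apply ip
      apply hφ.1
      rw [← hψ, ← hψ, hxy']
    · intro y
      obtain ⟨z, hz⟩ := hφ.2 (inducedQuot (LinearMap.ker f).subtype (1 : WittVector p k) y)
      have hz0 : z ∈ {x | inducedQuot f ((p : WittVector p k)) x = 0} := by
        show inducedQuot f _ z = 0
        apply hφ'.1
        rw [hcompat, hz, map_zero]
        have : inducedQuot (LinearMap.ker f).subtype (1 : WittVector p k) y ∈
          {x | inducedQuot f (1 : WittVector p k) x = 0} := r1 ▸ ⟨y, rfl⟩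
        exact this
      rw [← rp] at hz0
      obtain ⟨x, rfl⟩ := hz0
      refine ⟨x, i1 ?_⟩
      show inducedQuot _ _ (ψ x) = _
      rw [hψ, hz]
end
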